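/- For every ε > 0 there is a constant C = C(ε) such that for every squarefree positive integer q, every integer a coprime to q, and all real numbers M, N ≥ 1, the number of pairs (m, n) of positive integers with m ≤ M, n ≤ N and m·n² ≡ a (mod q) is at most C · q^ε · (M·N·q^(−1) + M·q^(−1/2) + N·q^(−1/2) + q^(1/2)). -/

import Mathlib

open Finset

section Stepanov
open Polynomial

/-- Polynomials whose degrees are pairwise distinct have no nontrivial linear relation. -/
theorem sum_smul_ne_zero_of_coeff_ne_zero {F : Type*} [Field F] {n : ℕ} (D : ℕ) (Φ : ℕ → F[X])
    (hdeg : ∀ s, (Φ s).natDegree ≤ D + s) (hcoeff : ∀ s, (Φ s).coeff (D + s) ≠ 0)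
    (c : Fin n → F) (hc : c ≠ 0) : ∑ s, c s • Φ s ≠ 0 := by
  classical
  obtain ⟨s₀, hs₀⟩ := Function.ne_iff.mp hc
  obtain ⟨s, hs, hmax⟩ := exists_max_image (univ.filter fun s => c s ≠ 0) id ⟨s₀, by simpa using hs₀⟩
  have hs' : c s ≠ 0 := by simpa using hs
  intro h
  have h1 := congrArg (fun P : F[X] => P.coeff (D + s)) h
  simp only [finsetSum_coeff, coeff_smul, coeff_zero, smul_eq_mul] at h1
  rw [sum_eq_single s] at h1
  · exact mul_ne_zero hs' (hcoeff s) h1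
  · intro u _ hus
    by_cases hu : c u = 0
    · simp [hu]
    · have hlt : u < s := lt_of_le_of_ne (hmax u (by simpa using hu)) hus
      rw [coeff_eq_zero_of_natDegree_lt, mul_zero]
      have := hdeg u
      have : (u : ℕ) < s := hlt
      omega
  · simp

/-- The half-trace `∑ i < m, f ^ (p ^ i)` of `f = A x⁻² + B x`, multiplied by `X ^ (2 p ^ (m - 1))`
to clear the pole at the origin. -/
noncomputable def halfTracePoly {p : ℕ} (A B : ZMod p) (m : ℕ) : (ZMod p)[X] :=
  ∑ i ∈ range (m + 1), (C A * X ^ (2 * p ^ m - 2 * p ^ i) + C B * X ^ (2 * p ^ m + p ^ i))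

theorem natDegree_halfTracePoly_le {p : ℕ} [Fact p.Prime] (A B : ZMod p) (m : ℕ) :
    (halfTracePoly A B m).natDegree ≤ 3 * p ^ m := by
  refine natDegree_sum_le_of_forall_le _ _ fun i hi => ?_
  have : p ^ i ≤ p ^ m :=
    Nat.pow_le_pow_right (Fact.out : p.Prime).pos (by simpa [Nat.lt_succ_iff] using hi)
  refine natDegree_add_le_of_degree_le ?_ ?_
  · exact (natDegree_C_mul_X_pow_le _ _).trans (by omega)
  · exact (natDegree_C_mul_X_pow_le _ _).trans (by omega)

theorem coeff_halfTracePoly {p : ℕ} [Fact p.Prime] (A B : ZMod p) (m : ℕ) :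
    (halfTracePoly A B m).coeff (3 * p ^ m) = B := by
  have hp : p.Prime := Fact.out
  have hpos : 0 < p ^ m := pow_pos hp.pos _
  rw [halfTracePoly, finsetSum_coeff, sum_eq_single m]
  · simp only [coeff_add, coeff_C_mul, coeff_X_pow]
    rw [if_neg (by omega), if_pos (by omega)]
    simp
  · intro i hi him
    have : p ^ i < p ^ m := Nat.pow_lt_pow_right hp.one_lt
      (lt_of_le_of_ne (by simpa [Nat.lt_succ_iff] using hi) him)
    simp only [coeff_add, coeff_C_mul, coeff_X_pow]
    rw [if_neg (by omega), if_neg (by omega)]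
    simp
  · simp

theorem aeval_halfTracePoly {p : ℕ} [Fact p.Prime] (A B : ZMod p) (m : ℕ) {K : Type*} [Field K]
    [Algebra (ZMod p) K] {x : K} (hx : x ≠ 0) :
    aeval x (halfTracePoly A B m) = x ^ (2 * p ^ m) *
      ∑ i ∈ range (m + 1), (algebraMap (ZMod p) K A * (x⁻¹) ^ 2 + algebraMap (ZMod p) K B * x) ^ p ^ i := by
  have hp : p.Prime := Fact.out
  have : CharP K p := charP_of_injective_algebraMap (algebraMap (ZMod p) K).injective p
  rw [halfTracePoly, map_sum, mul_sum]
  refine sum_congr rfl fun i hi => ?_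
  have hle : p ^ i ≤ p ^ m :=
    Nat.pow_le_pow_right hp.pos (by simpa [Nat.lt_succ_iff] using hi)
  rw [add_pow_char_pow, mul_pow, mul_pow, ← map_pow, ← map_pow, ZMod.pow_card_pow, ZMod.pow_card_pow]
  simp only [map_add, map_mul, aeval_C, map_pow, aeval_X]
  have h1 : x ^ (2 * p ^ m) = x ^ (2 * p ^ m - 2 * p ^ i) * x ^ (2 * p ^ i) := by
    rw [← pow_add]; congr 1; omega
  rw [mul_add, pow_add, h1, ← pow_mul, inv_pow]
  field_simp

/-- The auxiliary monomials `x ^ i * T ^ j * x ^ (Q (k + 2))` of Stepanov's method, where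
`s = i + R j + Q k` with `R = p ^ m`, `Q = p R`, and `T` is the half-trace. -/
noncomputable def stepanovPoly {p : ℕ} (A B : ZMod p) (m s : ℕ) : (ZMod p)[X] :=
  X ^ (2 * p ^ (m + 1) + s - 3 * p ^ m * ((s / p ^ m) % p)) *
    halfTracePoly A B m ^ ((s / p ^ m) % p)

/-- The polynomials that take the same values as the `p ^ (m + 1)`-th powers of `stepanovPoly`,
up to a monomial, on the points where the trace of `A x⁻² + B x` is `b`. -/
noncomputable def stepanovTwist {p : ℕ} (A B b : ZMod p) (m s : ℕ) : (ZMod p)[X] :=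
  X ^ ((s % p ^ m) * p ^ (m + 1) + s / p ^ (m + 1) + 2 * p ^ (m + 1) - 2 * p ^ m * ((s / p ^ m) % p)) *
    (C b * X ^ (2 * p ^ m) - halfTracePoly A B m) ^ ((s / p ^ m) % p)

theorem mixed_radix (p m s : ℕ) :
    s = s % p ^ m + p ^ m * ((s / p ^ m) % p) + p ^ (m + 1) * (s / p ^ (m + 1)) := by
  have h1 := Nat.mod_add_div s (p ^ m)
  have h2 := Nat.mod_add_div (s / p ^ m) p
  rw [Nat.div_div_eq_div_mul, ← pow_succ] at h2
  have h3 : p ^ m * (s / p ^ m) = p ^ m * ((s / p ^ m) % p) + p ^ (m + 1) * (s / p ^ (m + 1)) := by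
    conv_lhs => rw [← h2]
    ring
  omega

theorem digit_bounds {p : ℕ} (hp : p.Prime) (m s : ℕ) :
    s % p ^ m < p ^ m ∧ p ^ m * ((s / p ^ m) % p) + p ^ m ≤ p ^ (m + 1) := by
  refine ⟨Nat.mod_lt _ (pow_pos hp.pos _), ?_⟩
  have : (s / p ^ m) % p + 1 ≤ p := Nat.mod_lt _ hp.pos
  calc _ = p ^ m * ((s / p ^ m) % p + 1) := by ring
    _ ≤ p ^ m * p := Nat.mul_le_mul_left _ this
    _ = _ := (pow_succ _ _).symm

theorem natDegree_stepanovPoly_le {p : ℕ} [Fact p.Prime] (A B : ZMod p) (m s : ℕ) :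
    (stepanovPoly A B m s).natDegree ≤ 2 * p ^ (m + 1) + s := by
  have h1 := mixed_radix p m s
  have h2 := (digit_bounds (Fact.out : p.Prime) m s).2
  refine natDegree_mul_le_of_le (natDegree_X_pow_le _)
    (natDegree_pow_le_of_le _ (natDegree_halfTracePoly_le A B m)) |>.trans ?_
  set j := (s / p ^ m) % p
  set i := s % p ^ m
  clear_value i
  have h3 : 3 * p ^ m * j = 3 * (p ^ m * j) := by ring
  have h4 : j * (3 * p ^ m) = 3 * (p ^ m * j) := by ring
  rw [h3, h4]
  generalize p ^ (m + 1) * (s / p ^ (m + 1)) = w at h1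
  generalize p ^ (m + 1) = Q at *
  generalize p ^ m * j = u at *
  omega

theorem coeff_stepanovPoly {p : ℕ} [Fact p.Prime] (A B : ZMod p) (m s : ℕ) :
    (stepanovPoly A B m s).coeff (2 * p ^ (m + 1) + s) = B ^ ((s / p ^ m) % p) := by
  have h1 := mixed_radix p m s
  have h2 := (digit_bounds (Fact.out : p.Prime) m s).2
  rw [stepanovPoly]
  set j := (s / p ^ m) % p
  set i := s % p ^ m
  clear_value i
  have h3 : 3 * p ^ m * j = 3 * (p ^ m * j) := by ring
  have h4 : 2 * p ^ (m + 1) + s = j * (3 * p ^ m) + (2 * p ^ (m + 1) + s - 3 * p ^ m * j) := by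
    rw [show j * (3 * p ^ m) = 3 * (p ^ m * j) by ring, h3]
    generalize p ^ (m + 1) * (s / p ^ (m + 1)) = w at h1
    generalize p ^ (m + 1) = Q at *
    generalize p ^ m * j = u at *
    omega
  rw [mul_comm]
  generalize 2 * p ^ (m + 1) + s - 3 * p ^ m * j = v at h4 ⊢
  rw [h4, coeff_mul_X_pow, coeff_pow_of_natDegree_le (natDegree_halfTracePoly_le A B m), coeff_halfTracePoly]

theorem natDegree_stepanovTwist_lt {p : ℕ} [Fact p.Prime] (A B b : ZMod p) (m : ℕ) {s N : ℕ}
    (hs : s < p ^ (m + 1) * N) :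
    (stepanovTwist A B b m s).natDegree < p ^ m * p ^ (m + 1) + 2 * p ^ (m + 1) + N := by
  have hp : p.Prime := Fact.out
  obtain ⟨h1, h2⟩ := digit_bounds hp m s
  have h0 : 0 < p ^ m := pow_pos hp.pos _
  have h3 : s / p ^ (m + 1) < N := Nat.div_lt_of_lt_mul hs
  have h4 : (C b * X ^ (2 * p ^ m) - halfTracePoly A B m).natDegree ≤ 3 * p ^ m :=
    (natDegree_sub_le_of_le ((natDegree_C_mul_X_pow_le b (2 * p ^ m)).trans
      (show 2 * p ^ m ≤ 3 * p ^ m by omega)) (natDegree_halfTracePoly_le A B m)).trans (by simp)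
  refine (natDegree_mul_le_of_le (natDegree_X_pow_le _) (natDegree_pow_le_of_le _ h4)).trans_lt ?_
  set j := (s / p ^ m) % p
  have h5 : (s % p ^ m + 1) * p ^ (m + 1) ≤ p ^ m * p ^ (m + 1) := Nat.mul_le_mul_right _ h1
  have h6 : 2 * p ^ m * j = 2 * (p ^ m * j) := by ring
  have h7 : j * (3 * p ^ m) = 3 * (p ^ m * j) := by ring
  rw [add_mul, one_mul] at h5
  omega

/-- **Stepanov's bound** for the number of points over a finite field at which the absolute trace of
`A x⁻² + B x` takes a prescribed value. -/
theorem card_trace_eq_le {p : ℕ} [Fact p.Prime] (A : ZMod p) {B : ZMod p} (hB : B ≠ 0)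
    (m : ℕ) {K : Type*} [Field K] [Fintype K] [DecidableEq K] [Algebra (ZMod p) K]
    (hK : Module.finrank (ZMod p) K = 2 * (m + 1)) (b : ZMod p) :
    (univ.filter fun x : K => x ≠ 0 ∧ Algebra.trace (ZMod p) K
      (algebraMap (ZMod p) K A * (x⁻¹) ^ 2 + algebraMap (ZMod p) K B * x) = b).card
      ≤ p ^ m * p ^ (m + 1) + 8 * p ^ (m + 1) := by
  have hp : p.Prime := Fact.out
  have : CharP K p := charP_of_injective_algebraMap (algebraMap (ZMod p) K).injective p
  set Q := p ^ (m + 1) with hQ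
  set R := p ^ m with hR
  have hQR : Q = R * p := pow_succ _ _
  have hR0 : 0 < R := pow_pos hp.pos _
  have hQ2 : 2 * R ≤ Q := by rw [hQR, mul_comm]; exact Nat.mul_le_mul_left _ hp.two_le
  set D := R * Q + 2 * Q + (R + 6) with hD
  let L : (Fin (Q * (R + 6)) → ZMod p) →ₗ[ZMod p] degreeLT (ZMod p) D :=
    Fintype.linearCombination (ZMod p) fun s : Fin (Q * (R + 6)) =>
      (⟨stepanovTwist A B b m s, mem_degreeLT.mpr <| by
        refine lt_of_le_of_lt degree_le_natDegree ?_
        exact_mod_cast natDegree_stepanovTwist_lt A B b m s.2⟩ : degreeLT (ZMod p) D)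
  have hker : L.ker ≠ ⊥ := by
    apply LinearMap.ker_ne_bot_of_finrank_lt
    rw [(degreeLTEquiv (ZMod p) D).finrank_eq, Module.finrank_fin_fun, Module.finrank_fin_fun, hD]
    nlinarith
  obtain ⟨c, hcL, hc⟩ := (Submodule.ne_bot_iff _).mp hker
  have hΘ : ∑ s, c s • stepanovTwist A B b m s = 0 := by
    have := congrArg Subtype.val (LinearMap.mem_ker.mp hcL)
    simpa [L, Fintype.linearCombination_apply] using this
  set Ψ := ∑ s, c s • stepanovPoly A B m s with hΨ
  have hΨ0 : Ψ ≠ 0 := sum_smul_ne_zero_of_coeff_ne_zero (2 * Q) _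
    (natDegree_stepanovPoly_le A B m)
    (fun s => by rw [hQ, coeff_stepanovPoly]; exact pow_ne_zero _ hB) c hc
  have hΨdeg : Ψ.natDegree ≤ R * Q + 8 * Q := by
    refine natDegree_sum_le_of_forall_le _ _ fun s _ => (natDegree_smul_le _ _).trans ?_
    refine (natDegree_stepanovPoly_le A B m s).trans ?_
    have := s.2
    nlinarith
  have hΨK : Ψ.map (algebraMap (ZMod p) K) ≠ 0 := (Polynomial.map_ne_zero_iff (algebraMap (ZMod p) K).injective).mpr hΨ0
  refine le_trans (card_le_degree_of_subset_roots (p := Ψ.map (algebraMap (ZMod p) K)) ?_)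
    ((natDegree_map_le).trans hΨdeg)
  intro x hx
  simp only [mem_val, mem_filter, mem_univ, true_and] at hx
  obtain ⟨hx0, hxb⟩ := hx
  rw [mem_roots hΨK, IsRoot.def, eval_map_algebraMap]
  set f := algebraMap (ZMod p) K A * (x⁻¹) ^ 2 + algebraMap (ZMod p) K B * x with hf
  set τ := ∑ i ∈ range (m + 1), f ^ p ^ i with hτ
  have hτQ : τ ^ Q = algebraMap (ZMod p) K b - τ := by
    have h1 : τ ^ Q = ∑ i ∈ range (m + 1), f ^ p ^ (m + 1 + i) := by
      rw [hτ, hQ, sum_pow_char_pow]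
      refine sum_congr rfl fun i _ => ?_
      rw [← pow_mul, ← pow_add, add_comm]
    rw [eq_sub_iff_add_eq', ← hxb, FiniteField.algebraMap_trace_eq_sum_pow, hK, h1, two_mul,
      sum_range_add _ (m + 1), Nat.card_zmod]
  have hxQ : (x ^ Q) ^ Q = x := by
    have : Fintype.card K = Q * Q := by
      rw [Module.card_eq_pow_finrank (K := ZMod p), hK, ZMod.card, hQ, ← pow_add, two_mul]
    rw [← pow_mul, ← this, FiniteField.pow_card]
  have hcQ : ∀ a : ZMod p, a ^ Q = a := fun a => ZMod.pow_card_pow a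
  have hT : aeval x (halfTracePoly A B m) = x ^ (2 * R) * τ := aeval_halfTracePoly A B m hx0
  suffices h : (aeval x Ψ) ^ Q = 0 from pow_eq_zero_iff (pow_pos hp.pos _).ne' |>.mp h
  have key : ∀ s, (aeval x (stepanovPoly A B m s)) ^ Q = x ^ 2 * (x ^ (2 * Q))⁻¹ * aeval x (stepanovTwist A B b m s) := by
    intro s
    have h1 := mixed_radix p m s
    obtain ⟨h2, h3⟩ := digit_bounds hp m s
    rw [stepanovPoly, stepanovTwist]
    simp only [map_mul, map_pow, aeval_X, map_sub, aeval_C, hT]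
    set j := (s / p ^ m) % p
    set i := s % p ^ m
    set k := s / p ^ (m + 1)
    clear_value i j k
    rw [← hQ, ← hR] at h1 h3
    rw [← hR] at h2
    rw [← hQ, ← hR]
    have e1 : x ^ (2 * Q + s - 3 * R * j) * (x ^ (2 * R) * τ) ^ j =
        x ^ i * τ ^ j * x ^ (Q * (k + 2)) := by
      have h3j : 3 * R * j = 3 * (R * j) := by ring
      rw [mul_pow, ← pow_mul x, ← mul_assoc, ← pow_add x, mul_right_comm (x ^ i), ← pow_add x]
      congr 2
      have : Q * (k + 2) = Q * k + 2 * Q := by ring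
      rw [this, h3j, show 2 * R * j = 2 * (R * j) by ring]
      omega
    have e2 : x ^ (i * Q + k + 2 * Q - 2 * R * j) *
        (algebraMap (ZMod p) K b * x ^ (2 * R) - x ^ (2 * R) * τ) ^ j =
        x ^ (i * Q) * x ^ k * x ^ (2 * Q) * (algebraMap (ZMod p) K b - τ) ^ j := by
      rw [show algebraMap (ZMod p) K b * x ^ (2 * R) - x ^ (2 * R) * τ
        = x ^ (2 * R) * (algebraMap (ZMod p) K b - τ) by ring]
      rw [mul_pow, ← pow_mul x, ← mul_assoc, ← pow_add x, ← pow_add x, ← pow_add x]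
      congr 2
      rw [mul_assoc 2 R]
      omega
    rw [e1, e2, mul_pow, mul_pow, ← pow_mul τ, mul_comm j, pow_mul τ, hτQ, pow_mul x Q, pow_right_comm _ (k + 2),
      hxQ, ← pow_mul, pow_add x k 2]
    have : x ^ (2 * Q) ≠ 0 := pow_ne_zero _ hx0
    field_simp
  have h2 : (aeval x Ψ) ^ Q = x ^ 2 * (x ^ (2 * Q))⁻¹ * aeval x (∑ s, c s • stepanovTwist A B b m s) := by
    rw [hΨ, map_sum, map_sum, mul_sum]
    refine (sum_pow_char_pow p (m + 1) _ _).trans (sum_congr rfl fun s _ => ?_)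
    rw [map_smul, map_smul, Algebra.smul_def, mul_pow, ← hQ, key, ← map_pow, hcQ,
      Algebra.smul_def (c s) (aeval x _)]
    ring
  rw [h2, hΘ, map_zero, mul_zero]

end Stepanov

section CharacterSums
open Polynomial

/-- The sum of the inverse squares of the roots of a polynomial with nonzero constant term,
expressed through its lowest coefficients. -/
noncomputable def invSqRootSum {F : Type*} [Field F] (g : F[X]) : F :=
  (g.coeff 1 / g.coeff 0) ^ 2 - 2 * g.coeff 2 / g.coeff 0

theorem invSqRootSum_one {F : Type*} [Field F] : invSqRootSum (1 : F[X]) = 0 := by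
  simp [invSqRootSum, coeff_one]

theorem invSqRootSum_mul {F : Type*} [Field F] {g h : F[X]} (hg : g.coeff 0 ≠ 0)
    (hh : h.coeff 0 ≠ 0) : invSqRootSum (g * h) = invSqRootSum g + invSqRootSum h := by
  have h2 : (g * h).coeff 2 = g.coeff 0 * h.coeff 2 + g.coeff 1 * h.coeff 1 + g.coeff 2 * h.coeff 0 := by
    simp [coeff_mul, Finset.Nat.antidiagonal_succ]
    ring
  rw [invSqRootSum, h2, mul_coeff_zero, mul_coeff_one, invSqRootSum, invSqRootSum]
  field_simp
  ring

theorem invSqRootSum_map {F K : Type*} [Field F] [Field K] (f : F →+* K) (g : F[X]) :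
    invSqRootSum (g.map f) = f (invSqRootSum g) := by
  simp [invSqRootSum, map_ofNat]

theorem invSqRootSum_pow {F : Type*} [Field F] {g : F[X]} (hg : g.coeff 0 ≠ 0) (k : ℕ) :
    invSqRootSum (g ^ k) = k * invSqRootSum g := by
  induction k with
  | zero => simp [invSqRootSum_one]
  | succ k ih =>
    have : (g ^ k).coeff 0 ≠ 0 := by rw [coeff_zero_eq_eval_zero, eval_pow, ← coeff_zero_eq_eval_zero]; exact pow_ne_zero _ hg
    rw [pow_succ, invSqRootSum_mul this hg, ih]; push_cast; ring

theorem invSqRootSum_prod_X_sub_C {F ι : Type*} [Field F] (s : Finset ι) (r : ι → F)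
    (hr : ∀ i ∈ s, r i ≠ 0) : invSqRootSum (∏ i ∈ s, (X - C (r i))) = ∑ i ∈ s, (r i)⁻¹ ^ 2 := by
  classical
  induction s using Finset.induction_on with
  | empty => simp [invSqRootSum_one]
  | insert a s ha ih =>
    rw [prod_insert ha, sum_insert ha, invSqRootSum_mul, ih fun i hi => hr i (mem_insert_of_mem hi)]
    · congr 1
      simp [invSqRootSum, coeff_X, coeff_C, inv_neg]
    · simpa using hr a (mem_insert_self _ _)
    · rw [coeff_zero_eq_eval_zero, eval_prod, prod_ne_zero_iff]
      intro i hi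
      simpa using hr i (mem_insert_of_mem hi)

/-- The product over the Galois group of the conjugate linear factors is a power of the
minimal polynomial. -/
theorem prod_X_sub_C_algEquiv_eq_minpoly_pow {F K : Type*} [Field F] [Field K] [Algebra F K]
    [FiniteDimensional F K] [IsGalois F K] (x : K) :
    ∏ σ : K ≃ₐ[F] K, (X - C (σ x)) =
      ((minpoly F x) ^ (Module.finrank F K / (minpoly F x).natDegree)).map (algebraMap F K) := by
  classical
  obtain ⟨g, hg⟩ := Algebra.IsInvariant.charpoly_mem_lifts F K (K ≃ₐ[F] K) x
  have hg' : g.map (algebraMap F K) = ∏ σ : K ≃ₐ[F] K, (X - C (σ x)) := by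
    rw [← coe_mapRingHom, hg]; rfl
  have hmonic : g.Monic := by
    refine monic_of_injective (algebraMap F K).injective ?_
    rw [hg']; exact monic_prod_of_monic _ _ fun σ _ => monic_X_sub_C _
  have hdeg : g.natDegree = Module.finrank F K := by
    rw [← natDegree_map (algebraMap F K), hg', natDegree_prod_of_monic _ _ fun σ _ => monic_X_sub_C _]
    simp [← IsGalois.card_aut_eq_finrank, Nat.card_eq_fintype_card]
  have hxi : IsIntegral F x := .of_finite F x
  have hfac : ∀ P ∈ UniqueFactorizationMonoid.normalizedFactors g, P = minpoly F x := by
    intro P hP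
    have hirr := UniqueFactorizationMonoid.irreducible_of_normalized_factor P hP
    have hPm : P.Monic := by
      rw [← UniqueFactorizationMonoid.normalize_normalized_factor P hP]
      exact monic_normalize hirr.ne_zero
    obtain ⟨y, hy⟩ : ∃ y : AlgebraicClosure K, aeval y P = 0 :=
      IsAlgClosed.exists_aeval_eq_zero _ P (degree_pos_of_irreducible hirr).ne'
    have hy2 : aeval y g = 0 := by
      obtain ⟨c, hc⟩ := UniqueFactorizationMonoid.dvd_of_mem_normalizedFactors hP
      rw [hc, map_mul, hy, zero_mul]
    rw [← aeval_map_algebraMap K, hg', map_prod, prod_eq_zero_iff] at hy2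
    obtain ⟨σ, -, hσ⟩ := hy2
    rw [map_sub, aeval_X, aeval_C, sub_eq_zero] at hσ
    rw [hσ, aeval_algebraMap_apply, map_eq_zero_iff _ (algebraMap K (AlgebraicClosure K)).injective] at hy
    rw [minpoly.eq_of_irreducible_of_monic hirr hy hPm, minpoly.algEquiv_eq]
  have hprod := UniqueFactorizationMonoid.prod_normalizedFactors_eq hmonic.ne_zero
  rw [hmonic.normalize_eq_self, Multiset.eq_replicate_of_mem hfac, Multiset.prod_replicate] at hprod
  set k := Multiset.card (UniqueFactorizationMonoid.normalizedFactors g)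
  have hk : Module.finrank F K / (minpoly F x).natDegree = k := by
    rw [← hdeg, ← hprod, natDegree_pow, Nat.mul_div_cancel _ (minpoly.natDegree_pos hxi)]
  rw [hk, hprod, hg']

variable {p : ℕ} [Fact p.Prime]

/-- The completely multiplicative function on monic polynomials whose value at `g` is
`ψ (∑ (A r⁻² + B r))`, the sum running over the roots `r` of `g`; it vanishes if `g` has a root
at the origin. -/
noncomputable def rootChar (ψ : AddChar (ZMod p) ℂ) (A B : ZMod p) (g : (ZMod p)[X]) : ℂ :=
  if g.coeff 0 = 0 then 0 else ψ (A * invSqRootSum g - B * g.nextCoeff)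

theorem rootChar_one (ψ : AddChar (ZMod p) ℂ) (A B : ZMod p) : rootChar ψ A B 1 = 1 := by
  simp [rootChar, invSqRootSum_one, nextCoeff]

theorem rootChar_mul (ψ : AddChar (ZMod p) ℂ) (A B : ZMod p) {g h : (ZMod p)[X]} (hg : g.Monic)
    (hh : h.Monic) : rootChar ψ A B (g * h) = rootChar ψ A B g * rootChar ψ A B h := by
  by_cases h1 : g.coeff 0 = 0
  · simp [rootChar, h1]
  by_cases h2 : h.coeff 0 = 0
  · simp [rootChar, h2]
  rw [rootChar, rootChar, rootChar, if_neg h1, if_neg h2, if_neg (by simp [h1, h2]),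
    invSqRootSum_mul h1 h2, hg.nextCoeff_mul hh, ← AddChar.map_add_eq_mul]
  congr 1; ring

theorem rootChar_pow (ψ : AddChar (ZMod p) ℂ) (A B : ZMod p) {g : (ZMod p)[X]} (hg : g.Monic)
    (k : ℕ) : rootChar ψ A B (g ^ k) = rootChar ψ A B g ^ k := by
  induction k with
  | zero => simp [rootChar_one]
  | succ k ih => rw [pow_succ, rootChar_mul ψ A B (hg.pow k) hg, ih, pow_succ]

/-- The sum of `ψ (Tr (A x⁻² + B x))` over the nonzero elements of a finite field. -/
noncomputable def traceCharSum (ψ : AddChar (ZMod p) ℂ) (A B : ZMod p) (K : Type*) [Field K]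
    [Fintype K] [DecidableEq K] [Algebra (ZMod p) K] : ℂ :=
  ∑ x : K, if x = 0 then 0 else ψ (Algebra.trace (ZMod p) K
    (algebraMap (ZMod p) K A * (x⁻¹) ^ 2 + algebraMap (ZMod p) K B * x))

theorem rootChar_minpoly_pow (ψ : AddChar (ZMod p) ℂ) (A B : ZMod p) {K : Type*} [Field K]
    [Fintype K] [Algebra (ZMod p) K] {x : K} (hx : x ≠ 0) :
    rootChar ψ A B (minpoly (ZMod p) x) ^
        (Module.finrank (ZMod p) K / (minpoly (ZMod p) x).natDegree) =
      ψ (Algebra.trace (ZMod p) K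
        (algebraMap (ZMod p) K A * (x⁻¹) ^ 2 + algebraMap (ZMod p) K B * x)) := by
  have hxi : IsIntegral (ZMod p) x := .of_finite _ x
  have h0 : (minpoly (ZMod p) x).coeff 0 ≠ 0 := minpoly.coeff_zero_ne_zero hxi hx
  set k := Module.finrank (ZMod p) K / (minpoly (ZMod p) x).natDegree with hk
  have hk' : Module.finrank (IntermediateField.adjoin (ZMod p) {x}) K = k := by
    rw [hk, ← IntermediateField.adjoin.finrank hxi,
      ← Module.finrank_mul_finrank (ZMod p) (IntermediateField.adjoin (ZMod p) {x}) K,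
      Nat.mul_div_cancel_left _ Module.finrank_pos]
  have h1 : Algebra.trace (ZMod p) K x = k * -(minpoly (ZMod p) x).nextCoeff := by
    rw [trace_eq_finrank_mul_minpoly_nextCoeff, hk']
  have h2 : Algebra.trace (ZMod p) K ((x⁻¹) ^ 2) = k * invSqRootSum (minpoly (ZMod p) x) := by
    apply (algebraMap (ZMod p) K).injective
    rw [trace_eq_sum_automorphisms, ← invSqRootSum_pow h0, ← invSqRootSum_map,
      ← prod_X_sub_C_algEquiv_eq_minpoly_pow, invSqRootSum_prod_X_sub_C _ _ (by simpa using hx)]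
    simp
  have h3 : Algebra.trace (ZMod p) K (algebraMap (ZMod p) K A * (x⁻¹) ^ 2 +
      algebraMap (ZMod p) K B * x) =
      k • (A * invSqRootSum (minpoly (ZMod p) x) - B * (minpoly (ZMod p) x).nextCoeff) := by
    rw [← Algebra.smul_def, ← Algebra.smul_def, map_add, LinearMap.map_smul, LinearMap.map_smul,
      h1, h2, nsmul_eq_mul, smul_eq_mul, smul_eq_mul]
    ring
  rw [rootChar, if_neg h0, h3, AddChar.map_nsmul_eq_pow]

theorem finite_setOf_natDegree_le (F : Type*) [Field F] [Finite F] (d : ℕ) :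
    {g : F[X] | g.natDegree ≤ d}.Finite := by
  have : Finite (degreeLT F (d + 1)) := Module.finite_of_finite F
  refine Set.Finite.subset (Set.toFinite (degreeLT F (d + 1) : Set F[X])) fun g hg => ?_
  rw [SetLike.mem_coe, mem_degreeLT]
  refine lt_of_le_of_lt degree_le_natDegree ?_
  have : g.natDegree ≤ d := hg
  exact_mod_cast Nat.lt_succ_of_le this

/-- The monic polynomials of degree `d` over a finite field. -/
noncomputable def monicsOfDegree (F : Type*) [Field F] [Finite F] (d : ℕ) : Finset F[X] :=
  ((finite_setOf_natDegree_le F d).subset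
    (t := {g | g.Monic ∧ g.natDegree = d}) fun _ hg => hg.2.le).toFinset

theorem mem_monicsOfDegree {F : Type*} [Field F] [Finite F] {d : ℕ} {g : F[X]} :
    g ∈ monicsOfDegree F d ↔ g.Monic ∧ g.natDegree = d := by
  simp [monicsOfDegree]

/-- The monic irreducible polynomials of degree at most `d` over a finite field. -/
noncomputable def irreduciblesUpTo (F : Type*) [Field F] [Finite F] (d : ℕ) : Finset F[X] :=
  ((finite_setOf_natDegree_le F d).subset
    (t := {g | g.Monic ∧ Irreducible g ∧ g.natDegree ≤ d}) fun _ hg => hg.2.2).toFinset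

theorem mem_irreduciblesUpTo {F : Type*} [Field F] [Finite F] {d : ℕ} {g : F[X]} :
    g ∈ irreduciblesUpTo F d ↔ g.Monic ∧ Irreducible g ∧ g.natDegree ≤ d := by
  simp [irreduciblesUpTo]

theorem card_filter_minpoly_eq {K : Type*} [Field K] [Fintype K]
    [Algebra (ZMod p) K] [DecidableEq (ZMod p)[X]] {P : (ZMod p)[X]} (hP : P.Monic) (hirr : Irreducible P) :
    (univ.filter fun x : K => minpoly (ZMod p) x = P).card =
      if P.natDegree ∣ Module.finrank (ZMod p) K then P.natDegree else 0 := by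
  classical
  split_ifs with hdvd
  · have hsplit : (P.map (algebraMap (ZMod p) K)).Splits := by
      rw [hirr.natDegree_dvd_iff_dvd_X_pow_card_pow_sub_X] at hdvd
      have hs : ((X ^ Fintype.card K - X : (ZMod p)[X]).map (algebraMap (ZMod p) K)).Splits :=
        (FiniteField.isSplittingField_sub K (ZMod p)).splits
      rw [Nat.card_eq_fintype_card, ← Module.card_eq_pow_finrank] at hdvd
      exact hs.of_dvd (map_ne_zero (FiniteField.X_pow_card_sub_X_ne_zero _ Fintype.one_lt_card))
        ((map_dvd_map' _).mpr hdvd)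
    rw [← card_rootSet_eq_natDegree (K := K) (PerfectField.separable_of_irreducible hirr) hsplit, ← Set.toFinset_card]
    congr 1
    ext x
    simp only [mem_filter, mem_univ, true_and, Set.mem_toFinset, mem_rootSet]
    constructor
    · rintro rfl
      exact ⟨hP.ne_zero, minpoly.aeval _ _⟩
    · rintro ⟨-, h⟩
      exact (minpoly.eq_of_irreducible_of_monic hirr h hP).symm
  · rw [card_eq_zero, filter_eq_empty_iff]
    rintro x - rfl
    exact hdvd (minpoly.degree_dvd (.of_finite _ x))

theorem traceCharSum_eq_sum_irreducibles (ψ : AddChar (ZMod p) ℂ) (A B : ZMod p) {K : Type*} [Field K]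
    [Fintype K] [DecidableEq K] [Algebra (ZMod p) K] {d : ℕ} (hd : Module.finrank (ZMod p) K ≤ d) :
    traceCharSum ψ A B K = ∑ P ∈ irreduciblesUpTo (ZMod p) d,
      if P.natDegree ∣ Module.finrank (ZMod p) K then
        P.natDegree * rootChar ψ A B P ^ (Module.finrank (ZMod p) K / P.natDegree) else 0 := by
  classical
  have h1 : traceCharSum ψ A B K = ∑ x : K, rootChar ψ A B (minpoly (ZMod p) x) ^
        (Module.finrank (ZMod p) K / (minpoly (ZMod p) x).natDegree) := by
    refine sum_congr rfl fun x _ => ?_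
    split_ifs with hx
    · subst hx
      simp [rootChar, Module.finrank_pos.ne']
    · exact (rootChar_minpoly_pow ψ A B hx).symm
  rw [h1, ← sum_fiberwise_of_maps_to (t := irreduciblesUpTo (ZMod p) d) (g := minpoly (ZMod p))]
  · refine sum_congr rfl fun P hP => ?_
    rw [mem_irreduciblesUpTo] at hP
    have h2 : ∀ x ∈ univ.filter (fun x : K => minpoly (ZMod p) x = P),
        rootChar ψ A B (minpoly (ZMod p) x) ^
        (Module.finrank (ZMod p) K / (minpoly (ZMod p) x).natDegree) =
        rootChar ψ A B P ^ (Module.finrank (ZMod p) K / P.natDegree) := fun x hx => by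
      rw [(mem_filter.mp hx).2]
    rw [sum_congr rfl h2, sum_const, card_filter_minpoly_eq hP.1 hP.2.1, nsmul_eq_mul]
    split_ifs <;> simp
  · intro x _
    have hxi : IsIntegral (ZMod p) x := .of_finite _ x
    exact mem_irreduciblesUpTo.mpr ⟨minpoly.monic hxi, minpoly.irreducible hxi,
      (Nat.le_of_dvd Module.finrank_pos (minpoly.degree_dvd hxi)).trans hd⟩

end CharacterSums

section LFunction
open Polynomial

variable {p : ℕ} [Fact p.Prime]

theorem norm_traceCharSum_le {ψ : AddChar (ZMod p) ℂ} (hψ : ψ ≠ 0) (A : ZMod p) {B : ZMod p}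
    (hB : B ≠ 0) (m : ℕ) {K : Type*} [Field K] [Fintype K] [DecidableEq K] [Algebra (ZMod p) K]
    (hK : Module.finrank (ZMod p) K = 2 * (m + 1)) :
    ‖traceCharSum ψ A B K‖ ≤ 9 * p * (p : ℝ) ^ (m + 1) := by
  set t : K → ZMod p := fun x => Algebra.trace (ZMod p) K
    (algebraMap (ZMod p) K A * (x⁻¹) ^ 2 + algebraMap (ZMod p) K B * x) with ht
  set Z : ZMod p → ℕ := fun b => (univ.filter fun x : K => x ≠ 0 ∧ t x = b).card with hZ
  set c : ℕ := p ^ m * p ^ (m + 1) + 8 * p ^ (m + 1) with hc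
  have hZc : ∀ b, Z b ≤ c := fun b => card_trace_eq_le A hB m hK b
  have hfib : ∀ f : ZMod p → ℂ, ∑ x : K, (if x = 0 then 0 else f (t x)) = ∑ b, Z b * f b := by
    intro f
    rw [← sum_fiberwise univ t]
    refine sum_congr rfl fun b _ => ?_
    rw [hZ, ← nsmul_eq_mul, ← sum_const, sum_filter, sum_filter]
    refine sum_congr rfl fun x _ => ?_
    by_cases h1 : x = 0 <;> by_cases h2 : t x = b <;> simp [h1, h2]
  have htot : ∑ b, (Z b : ℝ) = (p : ℝ) ^ (2 * (m + 1)) - 1 := by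
    have h := hfib fun _ => 1
    have h2 : ∑ x : K, (if x = 0 then (0 : ℂ) else 1) = (p : ℂ) ^ (2 * (m + 1)) - 1 := by
      have : ∀ x : K, (if x = 0 then (0 : ℂ) else 1) = 1 - if x = 0 then 1 else 0 := by
        intro x; split_ifs <;> simp
      simp only [this, sum_sub_distrib, sum_ite_eq', mem_univ, if_true, sum_const, nsmul_eq_mul, card_univ]
      rw [Module.card_eq_pow_finrank (K := ZMod p) (V := K), hK, ZMod.card]
      simp
    rw [h2] at h
    simp only [mul_one] at h
    exact_mod_cast h.symm
  have hS : traceCharSum ψ A B K = ∑ b, ((Z b : ℂ) - c) * ψ b := by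
    have : traceCharSum ψ A B K = ∑ b, Z b * ψ b := hfib ψ
    simp only [this, sub_mul, sum_sub_distrib, ← mul_sum, AddChar.sum_eq_zero_iff_ne_zero.mpr hψ,
      mul_zero, sub_zero]
  rw [hS]
  have hp : (1 : ℝ) ≤ p := by exact_mod_cast (Fact.out : p.Prime).one_lt.le
  calc ‖∑ b, ((Z b : ℂ) - c) * ψ b‖ ≤ ∑ b, ((c : ℝ) - Z b) := by
        refine norm_sum_le_of_le _ fun b _ => ?_
        rw [norm_mul, AddChar.norm_apply, mul_one, norm_sub_rev]
        have : ((c : ℂ) - Z b) = (((c : ℝ) - Z b : ℝ) : ℂ) := by push_cast; rfl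
        rw [this, Complex.norm_real, Real.norm_of_nonneg]
        exact sub_nonneg.mpr (by exact_mod_cast hZc b)
    _ = 8 * p * (p : ℝ) ^ (m + 1) + 1 := by
        rw [sum_sub_distrib, htot, sum_const, card_univ, ZMod.card, hc, nsmul_eq_mul]
        push_cast
        ring
    _ ≤ 9 * p * (p : ℝ) ^ (m + 1) := by
        have : 1 ≤ (p : ℝ) * p ^ (m + 1) := one_le_mul_of_one_le_of_one_le hp (one_le_pow₀ hp)
        linarith

/-- Coefficients of the `L`-function attached to `rootChar`. -/
noncomputable def rootCharCoeff (ψ : AddChar (ZMod p) ℂ) (A B : ZMod p) (d : ℕ) : ℂ :=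
  ∑ g ∈ monicsOfDegree (ZMod p) d, rootChar ψ A B g

/-- Coefficients of the logarithmic derivative of the Euler product attached to `rootChar`. -/
noncomputable def rootCharPowerSum (ψ : AddChar (ZMod p) ℂ) (A B : ZMod p) (r : ℕ) : ℂ :=
  ∑ P ∈ irreduciblesUpTo (ZMod p) r,
    if P.natDegree ∣ r then P.natDegree * rootChar ψ A B P ^ (r / P.natDegree) else 0

theorem rootCharPowerSum_eq_of_le (ψ : AddChar (ZMod p) ℂ) (A B : ZMod p) {r d : ℕ} (hr : r ≠ 0)
    (hd : r ≤ d) : rootCharPowerSum ψ A B r = ∑ P ∈ irreduciblesUpTo (ZMod p) d,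
      if P.natDegree ∣ r then P.natDegree * rootChar ψ A B P ^ (r / P.natDegree) else 0 := by
  refine sum_subset (fun P hP => ?_) fun P hP hP' => if_neg fun h => hP' ?_
  · rw [mem_irreduciblesUpTo] at hP ⊢
    exact ⟨hP.1, hP.2.1, hP.2.2.trans hd⟩
  · rw [mem_irreduciblesUpTo] at hP ⊢
    exact ⟨hP.1, hP.2.1, Nat.le_of_dvd (Nat.pos_of_ne_zero hr) h⟩

theorem rootCharCoeff_zero (ψ : AddChar (ZMod p) ℂ) (A B : ZMod p) :
    rootCharCoeff ψ A B 0 = 1 := by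
  have : monicsOfDegree (ZMod p) 0 = {1} := by
    ext g
    rw [mem_monicsOfDegree, mem_singleton]
    exact ⟨fun h => h.1.natDegree_eq_zero.mp h.2, by rintro rfl; simp⟩
  rw [rootCharCoeff, this, sum_singleton, rootChar_one]

theorem sum_rootChar_filter_dvd (ψ : AddChar (ZMod p) ℂ) (A B : ZMod p) (d : ℕ) {Q : (ZMod p)[X]}
    (hQ : Q.Monic) [DecidablePred fun g : (ZMod p)[X] => Q ∣ g] :
    ∑ g ∈ (monicsOfDegree (ZMod p) d).filter (Q ∣ ·), rootChar ψ A B g =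
      if Q.natDegree ≤ d then rootChar ψ A B Q * rootCharCoeff ψ A B (d - Q.natDegree) else 0 := by
  split_ifs with h
  · rw [rootCharCoeff, mul_sum]
    symm
    refine sum_bij (fun g _ => Q * g) ?_ ?_ ?_ ?_
    · intro g hg
      rw [mem_monicsOfDegree] at hg
      rw [mem_filter, mem_monicsOfDegree, hQ.natDegree_mul hg.1, hg.2]
      exact ⟨⟨hQ.mul hg.1, by omega⟩, dvd_mul_right _ _⟩
    · intro g _ g' _ hgg
      exact mul_left_cancel₀ hQ.ne_zero hgg
    · intro g hg
      rw [mem_filter, mem_monicsOfDegree] at hg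
      obtain ⟨⟨hm, hd⟩, k, rfl⟩ := hg
      have hk : k.Monic := hQ.of_mul_monic_left hm
      refine ⟨k, ?_, rfl⟩
      rw [hQ.natDegree_mul hk] at hd
      exact mem_monicsOfDegree.mpr ⟨hk, by omega⟩
    · intro g hg
      exact (rootChar_mul ψ A B hQ (mem_monicsOfDegree.mp hg).1).symm
  · refine sum_eq_zero fun g hg => absurd ?_ h
    rw [mem_filter, mem_monicsOfDegree] at hg
    rw [← hg.1.2]
    exact natDegree_le_of_dvd hg.2 hg.1.1.ne_zero

theorem sum_irreducibles_pow_dvd {F : Type*} [Field F] [Finite F] {d : ℕ} {g : F[X]}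
    (hg : g ∈ monicsOfDegree F d) [DecidableRel fun a b : F[X] => a ∣ b] :
    ∑ P ∈ irreduciblesUpTo F d, ∑ k ∈ Icc 1 d, (if P ^ k ∣ g then P.natDegree else 0) = d := by
  classical
  rw [mem_monicsOfDegree] at hg
  obtain ⟨hm, hd⟩ := hg
  set s := UniqueFactorizationMonoid.normalizedFactors g with hs
  have hsP : ∀ P ∈ s, P.Monic ∧ Irreducible P := fun P hP => by
    have hirr := UniqueFactorizationMonoid.irreducible_of_normalized_factor P hP
    refine ⟨?_, hirr⟩
    rw [← UniqueFactorizationMonoid.normalize_normalized_factor P hP]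
    exact monic_normalize hirr.ne_zero
  have hprod : s.prod = g := by
    rw [hs, UniqueFactorizationMonoid.prod_normalizedFactors_eq hm.ne_zero, hm.normalize_eq_self]
  have hdeg : d = ∑ P ∈ s.toFinset, s.count P * P.natDegree := by
    rw [← hd, ← hprod, natDegree_multiset_prod_of_monic _ fun P hP => (hsP P hP).1,
      Finset.sum_multiset_map_count]
    simp
  have hsub : s.toFinset ⊆ irreduciblesUpTo F d := fun P hP => by
    rw [Multiset.mem_toFinset] at hP
    refine mem_irreduciblesUpTo.mpr ⟨(hsP P hP).1, (hsP P hP).2, ?_⟩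
    rw [← hd]
    exact natDegree_le_of_dvd (UniqueFactorizationMonoid.dvd_of_mem_normalizedFactors hP) hm.ne_zero
  conv_rhs => rw [hdeg]
  rw [sum_subset hsub fun P _ hP => by
    rw [Multiset.mem_toFinset, ← Multiset.count_eq_zero] at hP; rw [hP, zero_mul]]
  refine sum_congr rfl fun P hP => ?_
  rw [mem_irreduciblesUpTo] at hP
  have hiff : ∀ k, P ^ k ∣ g ↔ k ≤ s.count P := fun k => by
    rw [pow_dvd_iff_le_emultiplicity,
      UniqueFactorizationMonoid.emultiplicity_eq_count_normalizedFactors hP.2.1 hm.ne_zero,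
      hP.1.normalize_eq_self, Nat.cast_le]
  have hle : s.count P ≤ d := by
    have h1 := natDegree_le_of_dvd ((hiff _).mpr le_rfl) hm.ne_zero
    rw [natDegree_pow, hd] at h1
    exact (Nat.le_mul_of_pos_right _ hP.2.1.natDegree_pos).trans h1
  rw [← sum_filter, sum_const, smul_eq_mul]
  congr 1
  have : (Icc 1 d).filter (fun k => P ^ k ∣ g) = Icc 1 (s.count P) := by
    ext k
    simp only [mem_filter, mem_Icc, hiff]
    omega
  rw [this, Nat.card_Icc]
  omega

theorem sum_Icc_mul_le_eq_sum_Icc_dvd {M : Type*} [AddCommMonoid M] (d : ℕ) {e : ℕ} (he : 0 < e)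
    (f : ℕ → ℕ → M) : ∑ k ∈ Icc 1 d, (if k * e ≤ d then f k (k * e) else 0) =
      ∑ r ∈ Icc 1 d, if e ∣ r then f (r / e) r else 0 := by
  rw [← sum_filter, ← sum_filter]
  refine sum_bij (fun k _ => k * e) ?_ ?_ ?_ ?_
  · intro k hk
    simp only [mem_filter, mem_Icc] at hk ⊢
    exact ⟨⟨Nat.mul_pos hk.1.1 he, hk.2⟩, dvd_mul_left _ _⟩
  · intro k _ k' _ h
    exact Nat.eq_of_mul_eq_mul_right he h
  · intro r hr
    simp only [mem_filter, mem_Icc] at hr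
    obtain ⟨⟨h1, h2⟩, k, rfl⟩ := hr
    refine ⟨k, ?_, mul_comm _ _⟩
    simp only [mem_filter, mem_Icc]
    have hk : 0 < k := Nat.pos_of_mul_pos_left h1
    exact ⟨⟨hk, (Nat.le_mul_of_pos_left _ he).trans h2⟩, by rwa [mul_comm]⟩
  · intro k _
    rw [Nat.mul_div_cancel _ he]

theorem natCast_mul_rootCharCoeff (ψ : AddChar (ZMod p) ℂ) (A B : ZMod p) (d : ℕ) :
    d * rootCharCoeff ψ A B d =
      ∑ r ∈ Icc 1 d, rootCharPowerSum ψ A B r * rootCharCoeff ψ A B (d - r) := by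
  classical
  have h1 : ∀ r ∈ Icc 1 d, rootCharPowerSum ψ A B r * rootCharCoeff ψ A B (d - r) =
      ∑ P ∈ irreduciblesUpTo (ZMod p) d, if P.natDegree ∣ r then
        P.natDegree * rootChar ψ A B P ^ (r / P.natDegree) * rootCharCoeff ψ A B (d - r) else 0 := by
    intro r hr
    rw [mem_Icc] at hr
    rw [rootCharPowerSum_eq_of_le ψ A B (by omega) hr.2, sum_mul]
    exact sum_congr rfl fun P _ => by rw [ite_mul, zero_mul]
  rw [sum_congr rfl h1, sum_comm, rootCharCoeff, mul_sum]
  have h2 : ∀ g ∈ monicsOfDegree (ZMod p) d, (d : ℂ) * rootChar ψ A B g =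
      ∑ P ∈ irreduciblesUpTo (ZMod p) d, ∑ k ∈ Icc 1 d,
        if P ^ k ∣ g then P.natDegree * rootChar ψ A B g else 0 := by
    intro g hg
    conv_lhs => rw [← sum_irreducibles_pow_dvd hg]
    push_cast
    rw [sum_mul]
    refine sum_congr rfl fun P _ => ?_
    rw [sum_mul]
    exact sum_congr rfl fun k _ => by split_ifs <;> simp
  rw [sum_congr rfl h2, sum_comm]
  refine sum_congr rfl fun P hP => ?_
  rw [mem_irreduciblesUpTo] at hP
  rw [sum_comm, ← sum_Icc_mul_le_eq_sum_Icc_dvd d hP.2.1.natDegree_pos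
    fun k r => P.natDegree * rootChar ψ A B P ^ k * rootCharCoeff ψ A B (d - r)]
  refine sum_congr rfl fun k _ => ?_
  rw [← sum_filter, ← mul_sum, sum_rootChar_filter_dvd ψ A B d (hP.1.pow k), natDegree_pow,
    rootChar_pow ψ A B hP.1]
  split_ifs <;> ring

theorem rootCharCoeff_eq_zero {ψ : AddChar (ZMod p) ℂ} (hψ : ψ ≠ 0) (A : ZMod p) {B : ZMod p}
    (hB : B ≠ 0) {d : ℕ} (hd : 4 ≤ d) : rootCharCoeff ψ A B d = 0 := by
  obtain ⟨t, ht⟩ := AddChar.ne_zero_iff.mp hψ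
  set c : ZMod p := -(B⁻¹ * t) with hc
  have hadd : ∀ (c : ZMod p), ∀ g ∈ monicsOfDegree (ZMod p) d,
      g + C c * X ^ (d - 1) ∈ monicsOfDegree (ZMod p) d := by
    intro c g hg
    rw [mem_monicsOfDegree] at hg ⊢
    have hlt : (C c * X ^ (d - 1)).degree < g.degree := by
      rw [degree_eq_natDegree hg.1.ne_zero, hg.2]
      refine (degree_C_mul_X_pow_le _ _).trans_lt ?_
      exact_mod_cast (by omega : d - 1 < d)
    exact ⟨hg.1.add_of_left hlt, by rw [natDegree_add_eq_left_of_degree_lt hlt, hg.2]⟩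
  have hval : ∀ g ∈ monicsOfDegree (ZMod p) d,
      rootChar ψ A B (g + C c * X ^ (d - 1)) = ψ t * rootChar ψ A B g := by
    intro g hg
    have hg' := mem_monicsOfDegree.mp hg
    have hgc := mem_monicsOfDegree.mp (hadd c g hg)
    have hn : (g + C c * X ^ (d - 1)).nextCoeff = g.nextCoeff + c := by
      rw [nextCoeff_of_natDegree_pos (by omega), nextCoeff_of_natDegree_pos (by omega), hgc.2, hg'.2]
      simp
    have hlow : ∀ i < 3, (g + C c * X ^ (d - 1)).coeff i = g.coeff i := by
      intro i hi
      rw [coeff_add, coeff_C_mul, coeff_X_pow, if_neg (by omega)]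
      simp
    rw [rootChar, rootChar, hlow 0 (by omega), invSqRootSum, hlow 0 (by omega), hlow 1 (by omega),
      hlow 2 (by omega), ← invSqRootSum, hn]
    split_ifs
    · simp
    · rw [← AddChar.map_add_eq_mul]
      congr 1
      rw [hc]
      field_simp
      ring
  have heq : rootCharCoeff ψ A B d = ψ t * rootCharCoeff ψ A B d := by
    conv_rhs => rw [rootCharCoeff, mul_sum, ← sum_congr rfl hval]
    symm
    refine sum_nbij' (fun g => g + C c * X ^ (d - 1)) (fun g => g + C (-c) * X ^ (d - 1))
      (hadd c) (hadd (-c)) ?_ ?_ fun _ _ => rfl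
    · intro g _; simp
    · intro g _; simp
  have : (1 - ψ t) * rootCharCoeff ψ A B d = 0 := by rw [sub_mul, one_mul, ← heq, sub_self]
  exact (mul_eq_zero.mp this).resolve_left (sub_ne_zero.mpr (Ne.symm ht))

end LFunction

section WeilBound

theorem exists_roots_of_newton_identities {E S : ℕ → ℂ} (hE0 : E 0 = 1) (hE : ∀ d, 4 ≤ d → E d = 0)
    (hS : ∀ d, d * E d = ∑ r ∈ Icc 1 d, S r * E (d - r)) :
    ∃ x y z : ℂ, ∀ n, 1 ≤ n → S n = -(x ^ n + y ^ n + z ^ n) := by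
  have ha : (⟨1, E 1, E 2, E 3⟩ : Cubic ℂ).a ≠ 0 := one_ne_zero
  obtain ⟨x, y, z, h3⟩ := (Cubic.splits_iff_roots_eq_three (φ := RingHom.id ℂ) ha).mp
    (IsAlgClosed.splits _)
  have hb := Cubic.b_eq_three_roots ha h3
  have hc := Cubic.c_eq_three_roots ha h3
  have hd := Cubic.d_eq_three_roots ha h3
  simp only [RingHom.id_apply, one_mul] at hb hc hd
  have h1 := hS 1
  have h2 := hS 2
  have h3 := hS 3
  simp only [sum_Icc_succ_top (by norm_num : 1 ≤ 3), sum_Icc_succ_top (by norm_num : 1 ≤ 2),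
    Icc_self, sum_singleton, hE0, Nat.sub_self] at h1 h2 h3
  norm_num [hE0] at h1 h2 h3
  have e1 : S 1 = -(x + y + z) := by linear_combination -h1 + hb
  have e2 : S 2 = -(x ^ 2 + y ^ 2 + z ^ 2) := by
    rw [e1, hb, hc] at h2
    linear_combination -h2
  refine ⟨x, y, z, fun n => ?_⟩
  induction n using Nat.strong_induction_on with
  | _ n ih =>
    intro hn
    rcases (by omega : n = 1 ∨ n = 2 ∨ n = 3 ∨ 4 ≤ n) with rfl | rfl | rfl | hn4
    · simpa using e1
    · exact e2
    · rw [e1, e2, hb, hc, hd] at h3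
      linear_combination -h3
    · have hrec := hS n
      rw [hE n hn4, mul_zero] at hrec
      have hsub : Icc (n - 3) n ⊆ Icc 1 n := Icc_subset_Icc (by omega) le_rfl
      rw [← sum_subset hsub fun r hr hr' => by
        rw [mem_Icc] at hr hr'
        rw [hE (n - r) (by omega), mul_zero]] at hrec
      obtain ⟨m, rfl⟩ : ∃ m, n = m + 3 := ⟨n - 3, by omega⟩
      rw [Nat.add_sub_cancel, sum_Icc_succ_top (by omega), sum_Icc_succ_top (by omega),
        sum_Icc_succ_top (by omega), Icc_self, sum_singleton, Nat.sub_self, hE0,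
        (by omega : m + 3 - m = 3), (by omega : m + 3 - (m + 1) = 2),
        (by omega : m + 3 - (m + 2) = 1), ih m (by omega) (by omega),
        ih (m + 1) (by omega) (by omega), ih (m + 2) (by omega) (by omega), hb, hc, hd] at hrec
      linear_combination -hrec

theorem norm_sq_le_of_power_sums_le {x y z : ℂ} {C p : ℝ} (hp : 0 < p) (hC : 1 ≤ C)
    (h : ∀ k, 1 ≤ k → ‖x ^ (2 * k) + y ^ (2 * k) + z ^ (2 * k)‖ ≤ C * p ^ k) : ‖x‖ ^ 2 ≤ p := by
  have key : ∀ k, 1 ≤ k → (‖x‖ ^ 2) ^ k ≤ 2 * (C * p ^ k) := by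
    intro k hk
    set T := C * p ^ k with hT
    have hT0 : 0 < T := by positivity
    set w := x ^ (2 * k) with hw
    set u := y ^ (2 * k)
    set v := z ^ (2 * k)
    have b1 : ‖w + u + v‖ ≤ T := h k hk
    have b2 : ‖w ^ 2 + u ^ 2 + v ^ 2‖ ≤ T ^ 2 := by
      have := h (2 * k) (by omega)
      rw [show 2 * (2 * k) = 2 * k * 2 by ring, pow_mul, pow_mul y, pow_mul z] at this
      refine this.trans ?_
      rw [hT, mul_pow, ← pow_mul, mul_comm k 2]
      gcongr
      nlinarith
    have b3 : ‖w ^ 3 + u ^ 3 + v ^ 3‖ ≤ T ^ 3 := by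
      have := h (3 * k) (by omega)
      rw [show 2 * (3 * k) = 2 * k * 3 by ring, pow_mul, pow_mul y, pow_mul z] at this
      refine this.trans ?_
      rw [hT, mul_pow, ← pow_mul, mul_comm k 3]
      gcongr
      exact le_self_pow₀ hC (by norm_num)
    have hwn : (‖x‖ ^ 2) ^ k = ‖w‖ := by rw [hw, norm_pow, pow_mul]
    rw [hwn]
    set s := w + u + v with hs
    set s2 := w ^ 2 + u ^ 2 + v ^ 2 with hs2
    set s3 := w ^ 3 + u ^ 3 + v ^ 3 with hs3
    have hrel : w ^ 3 = s * w ^ 2 - (s ^ 2 - s2) / 2 * w + (s ^ 3 - 3 * s * s2 + 2 * s3) / 6 := by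
      rw [hs, hs2, hs3]; ring
    have c2 : ‖(s ^ 2 - s2) / 2‖ ≤ T ^ 2 := by
      rw [norm_div, Complex.norm_ofNat, div_le_iff₀ two_pos]
      calc ‖s ^ 2 - s2‖ ≤ ‖s‖ ^ 2 + ‖s2‖ := by
            rw [← norm_pow]; exact norm_sub_le _ _
        _ ≤ T ^ 2 + T ^ 2 := by gcongr
        _ = T ^ 2 * 2 := by ring
    have c3 : ‖(s ^ 3 - 3 * s * s2 + 2 * s3) / 6‖ ≤ T ^ 3 := by
      rw [norm_div, Complex.norm_ofNat, div_le_iff₀ (by norm_num)]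
      calc ‖s ^ 3 - 3 * s * s2 + 2 * s3‖ ≤ ‖s ^ 3‖ + ‖3 * s * s2‖ + ‖2 * s3‖ :=
            (norm_add_le _ _).trans (add_le_add_left (norm_sub_le _ _) _)
        _ = ‖s‖ ^ 3 + 3 * ‖s‖ * ‖s2‖ + 2 * ‖s3‖ := by simp
        _ ≤ T ^ 3 + 3 * T * T ^ 2 + 2 * T ^ 3 := by gcongr
        _ = T ^ 3 * 6 := by ring
    have hbound : ‖w‖ ^ 3 ≤ T * ‖w‖ ^ 2 + T ^ 2 * ‖w‖ + T ^ 3 := by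
      calc ‖w‖ ^ 3 = ‖w ^ 3‖ := (norm_pow _ _).symm
        _ ≤ ‖s * w ^ 2‖ + ‖(s ^ 2 - s2) / 2 * w‖ + ‖(s ^ 3 - 3 * s * s2 + 2 * s3) / 6‖ := by
            conv_lhs => rw [hrel]
            exact (norm_add_le _ _).trans (add_le_add_left (norm_sub_le _ _) _)
        _ ≤ _ := by
            rw [norm_mul, norm_mul, norm_pow]
            gcongr
    by_contra! hlt
    have hw0 : 0 ≤ ‖w‖ := norm_nonneg _
    nlinarith [mul_pos hT0 hT0, mul_nonneg hT0.le hw0, mul_nonneg (sub_nonneg.mpr hlt.le) (sq_nonneg ‖w‖),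
      mul_nonneg (sub_nonneg.mpr hlt.le) (mul_nonneg hT0.le hw0), mul_pos (mul_pos hT0 hT0) hT0,
      mul_pos (sub_pos.mpr hlt) (mul_pos hT0 hT0)]
  by_contra! hlt
  have hr : 1 < ‖x‖ ^ 2 / p := (one_lt_div hp).mpr hlt
  obtain ⟨n, hn⟩ := pow_unbounded_of_one_lt (2 * C) hr
  have h1 := key (n + 1) (by omega)
  have h2 : (‖x‖ ^ 2 / p) ^ n ≤ (‖x‖ ^ 2 / p) ^ (n + 1) := pow_le_pow_right₀ hr.le (by omega)
  have h3 : (‖x‖ ^ 2 / p) ^ (n + 1) ≤ 2 * C := by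
    rw [div_pow, div_le_iff₀ (by positivity)]
    linarith
  linarith

variable {p : ℕ} [Fact p.Prime]

theorem traceCharSum_eq_rootCharPowerSum (ψ : AddChar (ZMod p) ℂ) (A B : ZMod p) (K : Type*)
    [Field K] [Fintype K] [DecidableEq K] [Algebra (ZMod p) K] :
    traceCharSum ψ A B K = rootCharPowerSum ψ A B (Module.finrank (ZMod p) K) :=
  traceCharSum_eq_sum_irreducibles ψ A B le_rfl

theorem norm_rootCharPowerSum_one_le {ψ : AddChar (ZMod p) ℂ} (hψ : ψ ≠ 0) (A : ZMod p)
    {B : ZMod p} (hB : B ≠ 0) : ‖rootCharPowerSum ψ A B 1‖ ≤ 3 * √p := by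
  classical
  obtain ⟨x, y, z, hxyz⟩ := exists_roots_of_newton_identities (rootCharCoeff_zero ψ A B)
    (fun d hd => rootCharCoeff_eq_zero hψ A hB hd) (natCast_mul_rootCharCoeff ψ A B)
  have hp : (1 : ℝ) ≤ p := by exact_mod_cast (Fact.out : p.Prime).one_lt.le
  have hsum : ∀ k, 1 ≤ k → ‖x ^ (2 * k) + y ^ (2 * k) + z ^ (2 * k)‖ ≤ 9 * p * (p : ℝ) ^ k := by
    intro k hk
    obtain ⟨m, rfl⟩ : ∃ m, k = m + 1 := ⟨k - 1, by omega⟩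
    let := Fintype.ofFinite (GaloisField p (2 * (m + 1)))
    have hfin : Module.finrank (ZMod p) (GaloisField p (2 * (m + 1))) = 2 * (m + 1) :=
      GaloisField.finrank p (by omega)
    rw [← norm_neg, ← hxyz _ (by omega)]
    have := norm_traceCharSum_le hψ A hB m hfin
    rwa [traceCharSum_eq_rootCharPowerSum, hfin] at this
  have hC : (1 : ℝ) ≤ 9 * p := by linarith
  have hroot : ∀ w : ℂ, ‖w‖ ^ 2 ≤ p → ‖w‖ ≤ √p := fun w hw => Real.le_sqrt_of_sq_le hw
  have hx := hroot x (norm_sq_le_of_power_sums_le (by linarith) hC hsum)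
  have hy := hroot y (norm_sq_le_of_power_sums_le (y := x) (z := z) (by linarith) hC fun k hk => by
    rw [add_comm (y ^ _)]; exact hsum k hk)
  have hz := hroot z (norm_sq_le_of_power_sums_le (y := y) (z := x) (by linarith) hC fun k hk => by
    have := hsum k hk
    rwa [add_comm, ← add_assoc, add_right_comm, add_comm (z ^ _ + _), ← add_assoc, add_right_comm,
      add_comm (x ^ _ + _), add_comm (x ^ _), ← add_assoc] at this)
  rw [hxyz 1 le_rfl, norm_neg, pow_one, pow_one, pow_one]
  exact (norm_add₃_le).trans (by linarith)

theorem norm_sum_inv_sq_add_le {ψ : AddChar (ZMod p) ℂ} (hψ : ψ ≠ 0) (A : ZMod p)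
    {B : ZMod p} (hB : B ≠ 0) :
    ‖∑ x : ZMod p, if x = 0 then 0 else ψ (A * (x⁻¹) ^ 2 + B * x)‖ ≤ 3 * √p := by
  have h := traceCharSum_eq_rootCharPowerSum ψ A B (ZMod p)
  rw [Module.finrank_self] at h
  have h2 := norm_rootCharPowerSum_one_le hψ A hB
  rw [← h] at h2
  simpa [traceCharSum, Algebra.trace_self_apply] using h2

end WeilBound

section UnitSums

theorem exists_mulShift_eq {p : ℕ} [Fact p.Prime] {ψ : AddChar (ZMod p) ℂ} (hψ : ψ ≠ 0)
    (χ : AddChar (ZMod p) ℂ) : ∃ A, χ = ψ.mulShift A := by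
  have hinj := AddChar.to_mulShift_inj_of_isPrimitive (AddChar.IsPrimitive.of_ne_one hψ)
  have hcard : Nat.card (AddChar (ZMod p) ℂ) = Nat.card (ZMod p) := by
    simp [Nat.card_eq_fintype_card, AddChar.card_eq]
  obtain ⟨A, hA⟩ := (hinj.bijective_of_nat_card_le hcard.le).2 χ
  exact ⟨A, hA.symm⟩

/-- The sum of `χ₁ (u⁻²) χ₂ (u)` over the units of a finite ring. -/
noncomputable def unitCharSum {R : Type*} [CommRing R] [Fintype Rˣ] (χ₁ χ₂ : AddChar R ℂ) : ℂ :=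
  ∑ u : Rˣ, χ₁ (((u⁻¹ : Rˣ) : R) ^ 2) * χ₂ u

theorem norm_unitCharSum_le {R : Type*} [CommRing R] [Finite R] [Fintype Rˣ]
    (χ₁ χ₂ : AddChar R ℂ) : ‖unitCharSum χ₁ χ₂‖ ≤ Fintype.card Rˣ := by
  refine (norm_sum_le_of_le _ (f := fun u : Rˣ => χ₁ (((u⁻¹ : Rˣ) : R) ^ 2) * χ₂ u)
    (n := fun _ => 1) fun u _ => ?_).trans (by simp)
  rw [norm_mul, AddChar.norm_apply, AddChar.norm_apply, mul_one]

theorem sum_units_eq_sum_ite {F M : Type*} [Field F] [Fintype F] [DecidableEq F] [AddCommMonoid M]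
    [Fintype Fˣ] (f : F → M) : ∑ u : Fˣ, f u = ∑ x : F, if x = 0 then 0 else f x := by
  rw [sum_congr rfl fun x _ => (ite_not (x = 0) (f x) 0).symm, ← sum_filter]
  refine sum_bij (fun u _ => (u : F)) ?_ ?_ ?_ ?_
  · simp
  · intro u _ v _ h; exact Units.ext h
  · intro x hx
    exact ⟨Units.mk0 x (by simpa using hx), mem_univ _, rfl⟩
  · simp

theorem norm_sum_sq_le {p : ℕ} [Fact p.Prime] (hp2 : p ≠ 2) {ψ : AddChar (ZMod p) ℂ}
    (hψ : ψ ≠ 0) : ‖∑ x : ZMod p, ψ (x ^ 2)‖ = √p := by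
  have h2 : (2 : ZMod p) ≠ 0 := by
    refine Ring.two_ne_zero ?_
    rwa [ZMod.ringChar_zmod_n]
  set G := ∑ x : ZMod p, ψ (x ^ 2) with hG
  have hconj : G * (starRingEnd ℂ) G = p := by
    have h1 : G * (starRingEnd ℂ) G = ∑ y : ZMod p, ∑ x : ZMod p, ψ (x ^ 2 - y ^ 2) := by
      rw [hG, map_sum, mul_sum]
      refine sum_congr rfl fun y _ => ?_
      rw [sum_mul]
      refine sum_congr rfl fun x _ => ?_
      rw [← AddChar.map_neg_eq_conj, ← AddChar.map_add_eq_mul, sub_eq_add_neg]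
    have h3 : ∀ y : ZMod p, ∑ x : ZMod p, ψ (x ^ 2 - y ^ 2) =
        ∑ h : ZMod p, ψ (h ^ 2) * ψ (y * (2 * h)) := fun y => by
      rw [← Equiv.sum_comp (Equiv.addRight y)]
      refine sum_congr rfl fun x _ => ?_
      rw [← AddChar.map_add_eq_mul, Equiv.coe_addRight]
      congr 1; ring
    rw [h1, sum_congr rfl fun y _ => h3 y, sum_comm]
    simp_rw [← mul_sum, AddChar.sum_mulShift _ (AddChar.IsPrimitive.of_ne_one hψ)]
    simp [h2]
  have : ‖G‖ ^ 2 = p := by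
    have := congrArg norm hconj
    rw [norm_mul, RCLike.norm_conj, Complex.norm_natCast] at this
    rw [sq, this]
  rw [← this, Real.sqrt_sq (norm_nonneg _)]

/-- Conductor weight in the bound for `unitCharSum`. -/
noncomputable def conductorWeight {q : ℕ} (χ₁ χ₂ : AddChar (ZMod q) ℂ) : ℝ :=
  open Classical in
  ∑ e ∈ q.divisors, if (∀ x, χ₁ (e * x) = 1) ∧ ∀ x, χ₂ (e * x) = 1 then √((q : ℝ) / e) else 0

theorem norm_unitCharSum_prime_le {p : ℕ} [Fact p.Prime] (χ₁ χ₂ : AddChar (ZMod p) ℂ) :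
    ‖unitCharSum χ₁ χ₂‖ ≤ 3 * √p * conductorWeight χ₁ χ₂ := by
  have hprime := (Fact.out : p.Prime)
  have hp : (1 : ℝ) ≤ p := by exact_mod_cast hprime.one_lt.le
  have hsp : 1 ≤ √p := Real.one_le_sqrt.mpr hp
  have hss : √(p : ℝ) * √p = p := Real.mul_self_sqrt (by linarith)
  have hW : conductorWeight χ₁ χ₂ = (open Classical in if (∀ x, χ₁ x = 1) ∧ ∀ x, χ₂ x = 1
      then √(p : ℝ) else 0) + 1 := by
    rw [conductorWeight, hprime.divisors, sum_pair hprime.one_lt.ne]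
    simp
  have hcard : (Fintype.card (ZMod p)ˣ : ℝ) ≤ p - 1 := by
    rw [ZMod.card_units, Nat.cast_sub hprime.one_lt.le, Nat.cast_one]
  have htriv := norm_unitCharSum_le χ₁ χ₂
  have hW1 : 1 ≤ conductorWeight χ₁ χ₂ := by
    rw [hW]; split_ifs <;> linarith
  suffices h : ‖unitCharSum χ₁ χ₂‖ ≤ 3 * √p * 1 ∨ ((∀ x, χ₁ x = 1) ∧ ∀ x, χ₂ x = 1) by
    rcases h with h | h
    · exact h.trans (by gcongr)
    · rw [hW, if_pos h]
      nlinarith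
  by_cases h2 : χ₂ = 0
  · by_cases h1 : χ₁ = 0
    · right
      subst h1 h2
      simp
    · left
      by_cases hp2 : p = 2
      · refine htriv.trans (hcard.trans ?_)
        rw [hp2] at hsp ⊢
        push_cast at hsp ⊢
        linarith
      · have hS : unitCharSum χ₁ χ₂ = ∑ x : ZMod p, χ₁ (x ^ 2) - 1 := by
          rw [unitCharSum, ← Equiv.sum_comp (Equiv.inv _)]
          simp only [Equiv.inv_apply, inv_inv, h2, AddChar.zero_apply, mul_one]
          rw [sum_units_eq_sum_ite fun x : ZMod p => χ₁ (x ^ 2), eq_sub_iff_add_eq]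
          rw [← Fintype.sum_ite_eq (0 : ZMod p) fun _ => (1 : ℂ), ← sum_add_distrib]
          refine sum_congr rfl fun x _ => ?_
          by_cases hx : x = 0
          · simp [hx]
          · simp [hx, Ne.symm hx]
        rw [hS]
        refine (norm_sub_le _ _).trans ?_
        rw [norm_sum_sq_le hp2 h1, norm_one]
        linarith
  · left
    obtain ⟨A, rfl⟩ := exists_mulShift_eq h2 χ₁
    have := norm_sum_inv_sq_add_le h2 A one_ne_zero
    rw [mul_one]
    convert this using 2
    rw [unitCharSum, ← sum_units_eq_sum_ite fun x => χ₂ (A * (x⁻¹) ^ 2 + 1 * x)]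
    refine sum_congr rfl fun u _ => ?_
    rw [AddChar.mulShift_apply, ← AddChar.map_add_eq_mul, one_mul, Units.val_inv_eq_inv_val]

theorem unitCharSum_eq_mul {R S T : Type*} [CommRing R] [CommRing S] [CommRing T] [Fintype Rˣ]
    [Fintype Sˣ] [Fintype Tˣ] (φ : R ≃+* S × T) (χ₁ χ₂ : AddChar R ℂ) :
    let f : S →+ R := φ.symm.toAddMonoidHom.comp (AddMonoidHom.inl S T)
    let g : T →+ R := φ.symm.toAddMonoidHom.comp (AddMonoidHom.inr S T)
    unitCharSum χ₁ χ₂ = unitCharSum (χ₁.compAddMonoidHom f) (χ₂.compAddMonoidHom f) *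
      unitCharSum (χ₁.compAddMonoidHom g) (χ₂.compAddMonoidHom g) := by
  intro f g
  have hχ : ∀ (χ : AddChar R ℂ) (r : R), χ r = χ (f (φ r).1) * χ (g (φ r).2) := by
    intro χ r
    rw [← AddChar.map_add_eq_mul]
    congr 1
    apply φ.injective
    simp [f, g]
  rw [unitCharSum, unitCharSum, unitCharSum, sum_mul_sum, ← sum_product', univ_product_univ]
  refine Fintype.sum_equiv ((Units.mapEquiv φ.toMulEquiv).trans MulEquiv.prodUnits).toEquiv _ _
    fun u => ?_
  rw [hχ χ₁, hχ χ₂, mul_mul_mul_comm]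
  simp only [map_pow, Prod.pow_fst, Prod.pow_snd]
  rfl

theorem sum_divisors_mul_le {m n : ℕ} (hmn : m.Coprime n) (f : ℕ → ℝ) (g h : ℕ → ℝ)
    (hf : ∀ a ∈ m.divisors, ∀ b ∈ n.divisors, g a * h b ≤ f (a * b)) :
    (∑ a ∈ m.divisors, g a) * ∑ b ∈ n.divisors, h b ≤ ∑ e ∈ (m * n).divisors, f e := by
  rw [sum_mul_sum, ← sum_product', Nat.divisors_mul, Finset.mul_def,
    sum_image (hmn.mul_injOn_divisors)]
  exact sum_le_sum fun x hx => hf _ (mem_product.mp hx).1 _ (mem_product.mp hx).2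

theorem norm_unitCharSum_squarefree_le {q : ℕ} (hq : Squarefree q) [inst : NeZero q]
    (χ₁ χ₂ : AddChar (ZMod q) ℂ) :
    ‖unitCharSum χ₁ χ₂‖ ≤ 3 ^ q.primeFactors.card * √q * conductorWeight χ₁ χ₂ := by
  induction q using Nat.recOnPosPrimePosCoprime generalizing inst with
  | zero => exact absurd rfl (NeZero.ne 0)
  | one =>
    refine (norm_unitCharSum_le _ _).trans ?_
    have h1 : ∀ (χ : AddChar (ZMod 1) ℂ) (x : ZMod 1), χ x = 1 := fun χ x => by
      rw [Subsingleton.elim x 0, AddChar.map_zero_eq_one]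
    simp [conductorWeight, h1]
  | prime_pow p n hp hn =>
    obtain rfl : n = 1 := by
      by_contra h
      have := (Nat.squarefree_pow_iff hp.ne_one hn.ne').mp hq
      exact h this.2
    have := Fact.mk hp
    have key : ∀ k, k = p → ∀ [NeZero k] (χ₁ χ₂ : AddChar (ZMod k) ℂ), ‖unitCharSum χ₁ χ₂‖ ≤
        3 ^ k.primeFactors.card * √k * conductorWeight χ₁ χ₂ := by
      rintro k rfl _ χ₁ χ₂
      rw [hp.primeFactors, card_singleton, pow_one]
      convert norm_unitCharSum_prime_le χ₁ χ₂
    exact key _ (pow_one p) χ₁ χ₂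
  | coprime m n hm hn hmn ihm ihn =>
    have : NeZero m := ⟨by omega⟩
    have : NeZero n := ⟨by omega⟩
    have hsq := Nat.squarefree_mul_iff.mp hq
    set φ := ZMod.chineseRemainder hmn with hφ
    rw [unitCharSum_eq_mul φ, norm_mul, Nat.primeFactors_mul (by omega) (by omega),
      card_union_of_disjoint hmn.disjoint_primeFactors]
    set f : ZMod m →+ ZMod (m * n) := φ.symm.toAddMonoidHom.comp (AddMonoidHom.inl _ _) with hf
    set g : ZMod n →+ ZMod (m * n) := φ.symm.toAddMonoidHom.comp (AddMonoidHom.inr _ _) with hg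
    refine (mul_le_mul (ihm hsq.2.1 _ _) (ihn hsq.2.2 _ _) (norm_nonneg _)
      ((norm_nonneg _).trans (ihm hsq.2.1 _ _))).trans ?_
    have hχ : ∀ (χ : AddChar (ZMod (m * n)) ℂ) (a b : ℕ),
        (∀ x, χ.compAddMonoidHom f (a * x) = 1) → (∀ x, χ.compAddMonoidHom g (b * x) = 1) →
        ∀ x, χ ((a * b : ℕ) * x) = 1 := by
      intro χ a b ha hb x
      have hx : ((a * b : ℕ) * x : ZMod (m * n)) =
          f (a * (b * (φ x).1)) + g (b * (a * (φ x).2)) := by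
        apply φ.injective
        ext <;> simp [hf, hg] <;> ring
      rw [hx, AddChar.map_add_eq_mul]
      have h1 := ha (b * (φ x).1)
      have h2 := hb (a * (φ x).2)
      rw [AddChar.compAddMonoidHom_apply] at h1 h2
      rw [h1, h2, one_mul]
    have hW : conductorWeight (χ₁.compAddMonoidHom f) (χ₂.compAddMonoidHom f) *
        conductorWeight (χ₁.compAddMonoidHom g) (χ₂.compAddMonoidHom g) ≤
        conductorWeight χ₁ χ₂ := by
      rw [conductorWeight, conductorWeight, conductorWeight]
      refine sum_divisors_mul_le hmn _ _ _ fun a ha b hb => ?_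
      split_ifs with h1 h2 h3 h3 <;> try simp only [mul_zero, zero_mul, le_refl, Real.sqrt_nonneg]
      · rw [← Real.sqrt_mul (by positivity)]
        apply Real.sqrt_le_sqrt
        push_cast
        rw [div_mul_div_comm]
      · exact absurd ⟨hχ χ₁ a b h1.1 h2.1, hχ χ₂ a b h1.2 h2.2⟩ h3
    have hcast : √((m * n : ℕ) : ℝ) = √(m : ℝ) * √n := by
      rw [Nat.cast_mul, Real.sqrt_mul (Nat.cast_nonneg _)]
    rw [hcast, pow_add]
    refine le_of_eq_of_le ?_ (mul_le_mul_of_nonneg_left hW (by positivity))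
    ring

end UnitSums

section Completion

/-- The number of pairs in `[1, L]²` whose difference is `x` modulo `q`. -/
def differenceCount {q : ℕ} (L : ℕ) (x : ZMod q) : ℕ :=
  ((Icc 1 L ×ˢ Icc 1 L).filter fun r : ℕ × ℕ => (r.1 : ZMod q) - r.2 = x).card

theorem mul_card_filter_le_differenceCount {q : ℕ} (L : ℕ) (x : ZMod q) :
    L * ((Icc 1 L).filter fun m : ℕ => (m : ZMod q) = x).card ≤ differenceCount (2 * L) x := by
  have h : L * ((Icc 1 L).filter fun m : ℕ => (m : ZMod q) = x).card =
      (((Icc 1 L).filter fun m : ℕ => (m : ZMod q) = x) ×ˢ Icc 1 L).card := by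
    rw [card_product, Nat.card_Icc, Nat.add_sub_cancel, mul_comm]
  rw [h]
  refine card_le_card_of_injOn (fun r => (r.1 + r.2, r.2)) ?_ ?_
  · intro r hr
    simp only [coe_product, Set.mem_prod, mem_coe, mem_filter, mem_Icc, mem_product] at hr ⊢
    refine ⟨by omega, ?_⟩
    push_cast
    rw [add_sub_cancel_right, hr.1.2]
  · rintro ⟨a, b⟩ _ ⟨c, d⟩ _ h
    simp only [Prod.mk.injEq] at h ⊢
    omega

variable {q : ℕ} [NeZero q]

theorem sum_norm_sq_sum_Icc_mul (L : ℕ) (x : ZMod q) :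
    ∑ χ : AddChar (ZMod q) ℂ, (‖∑ i ∈ Icc 1 L, χ (i : ZMod q)‖ ^ 2 : ℝ) * χ (-x) =
      q * differenceCount L x := by
  have h : ∀ χ : AddChar (ZMod q) ℂ, ((‖∑ i ∈ Icc 1 L, χ (i : ZMod q)‖ ^ 2 : ℝ) : ℂ) * χ (-x) =
      ∑ r ∈ Icc 1 L ×ˢ Icc 1 L, χ ((r.1 : ZMod q) - r.2 - x) := by
    intro χ
    rw [Complex.ofReal_pow, ← Complex.mul_conj', map_sum, sum_mul_sum, ← sum_product', sum_mul]
    refine sum_congr rfl fun r _ => ?_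
    rw [← AddChar.map_neg_eq_conj, ← AddChar.map_add_eq_mul, ← AddChar.map_add_eq_mul,
      sub_eq_add_neg, sub_eq_add_neg]
  rw [sum_congr rfl fun χ _ => h χ, sum_comm]
  simp_rw [AddChar.sum_apply_eq_ite, sub_eq_zero, ZMod.card]
  rw [← sum_filter, sum_const, nsmul_eq_mul, mul_comm, differenceCount]

theorem card_filter_le_sum_units {a : ZMod q} (ha : IsUnit a) (s t : Finset ℕ) :
    ((s ×ˢ t).filter fun r : ℕ × ℕ => (r.1 : ZMod q) * (r.2 : ZMod q) ^ 2 = a).card ≤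
      ∑ u : (ZMod q)ˣ, (s.filter fun m : ℕ => (m : ZMod q) = a * ((u⁻¹ : (ZMod q)ˣ) : ZMod q) ^ 2).card *
        (t.filter fun n : ℕ => (n : ZMod q) = u).card := by
  classical
  simp_rw [← card_product]
  refine (card_le_card fun r hr => ?_).trans card_biUnion_le
  rw [mem_filter, mem_product] at hr
  have hu : IsUnit (r.2 : ZMod q) := by
    rw [← hr.2] at ha
    exact isUnit_pow_iff two_ne_zero |>.mp (isUnit_of_mul_isUnit_right ha)
  obtain ⟨u, hu⟩ := hu
  rw [mem_biUnion]
  refine ⟨u, mem_univ _, ?_⟩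
  rw [mem_product, mem_filter, mem_filter]
  refine ⟨⟨hr.1.1, ?_⟩, hr.1.2, hu.symm⟩
  rw [← hr.2, ← hu, mul_assoc, ← mul_pow, Units.mul_inv, one_pow, mul_one]

theorem sum_units_differenceCount_mul (a : ZMod q) (L₁ L₂ : ℕ) :
    (q : ℂ) ^ 2 * ∑ u : (ZMod q)ˣ,
        differenceCount L₁ (a * ((u⁻¹ : (ZMod q)ˣ) : ZMod q) ^ 2) * differenceCount L₂ (u : ZMod q) =
      ∑ χ₁ : AddChar (ZMod q) ℂ, ∑ χ₂ : AddChar (ZMod q) ℂ,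
        (‖∑ i ∈ Icc 1 L₁, χ₁ (i : ZMod q)‖ ^ 2 : ℝ) * (‖∑ i ∈ Icc 1 L₂, χ₂ (i : ZMod q)‖ ^ 2 : ℝ) *
          unitCharSum (χ₁.mulShift (-a)) (χ₂.mulShift (-1)) := by
  have h : ∀ u : (ZMod q)ˣ, (q : ℂ) ^ 2 *
      (differenceCount L₁ (a * ((u⁻¹ : (ZMod q)ˣ) : ZMod q) ^ 2) * differenceCount L₂ (u : ZMod q)) =
      ∑ χ₁ : AddChar (ZMod q) ℂ, ∑ χ₂ : AddChar (ZMod q) ℂ,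
        (‖∑ i ∈ Icc 1 L₁, χ₁ (i : ZMod q)‖ ^ 2 : ℝ) * (‖∑ i ∈ Icc 1 L₂, χ₂ (i : ZMod q)‖ ^ 2 : ℝ) *
          (χ₁.mulShift (-a) (((u⁻¹ : (ZMod q)ˣ) : ZMod q) ^ 2) * χ₂.mulShift (-1) u) := by
    intro u
    rw [sq, mul_mul_mul_comm, ← sum_norm_sq_sum_Icc_mul, ← sum_norm_sq_sum_Icc_mul, sum_mul_sum]
    refine sum_congr rfl fun χ₁ _ => sum_congr rfl fun χ₂ _ => ?_
    rw [AddChar.mulShift_apply, AddChar.mulShift_apply, neg_mul, neg_one_mul]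
    ring
  push_cast at h ⊢
  rw [mul_sum, sum_congr rfl fun u _ => h u, sum_comm]
  refine sum_congr rfl fun χ₁ _ => ?_
  rw [sum_comm]
  refine sum_congr rfl fun χ₂ _ => ?_
  rw [← mul_sum, unitCharSum]

theorem card_filter_mul_eq_le {e : ℕ} (he : 0 < e) (z : ZMod q) :
    (univ.filter fun y : ZMod q => e * y = z).card ≤ e := by
  classical
  rcases (univ.filter fun y : ZMod q => e * y = z).eq_empty_or_nonempty with h | ⟨y₀, hy₀⟩
  · rw [h, card_empty]; exact he.le
  · refine le_trans ?_ (IsAddCyclic.card_nsmul_eq_zero_le (α := ZMod q) he)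
    refine card_le_card_of_injOn (fun y => y - y₀) ?_ fun y _ y' _ h => sub_left_injective h
    intro y hy
    simp only [coe_filter, mem_filter, mem_univ, true_and, Set.mem_ofPred_eq] at hy hy₀ ⊢
    rw [nsmul_eq_mul, mul_sub, hy, hy₀, sub_self]

theorem card_filter_modEq_le {e : ℕ} (he : 0 < e) (L i : ℕ) :
    e * ((Icc 1 L).filter fun j => j ≡ i [MOD e]).card ≤ L + e := by
  have h := Nat.Ioc_filter_modEq_card 0 L he i
  have h2 : Icc 1 L = Ioc 0 L := rfl
  rw [h2]
  have he' : (0 : ℚ) < e := by exact_mod_cast he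
  have h3 : (((Ioc 0 L).filter fun j => j ≡ i [MOD e]).card : ℚ) ≤ (L : ℚ) / e + 1 := by
    have h4 : (((Ioc 0 L).filter fun j => j ≡ i [MOD e]).card : ℚ) =
      ((((Ioc 0 L).filter fun j => j ≡ i [MOD e]).card : ℤ) : ℚ) := by push_cast; rfl
    rw [h4, h]
    have f1 := Int.floor_le (((L : ℕ) - i : ℚ) / e)
    have f2 := Int.lt_floor_add_one (((0 : ℕ) - i : ℚ) / e)
    have f3 : ((L : ℕ) - i : ℚ) / e - ((0 : ℕ) - i : ℚ) / e = L / e := by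
      field_simp; push_cast; ring
    push_cast at f1 f2 f3 ⊢
    refine max_le ?_ (by positivity)
    linarith
  have h5 : (e : ℚ) * (((Ioc 0 L).filter fun j => j ≡ i [MOD e]).card : ℚ) ≤ L + e := by
    calc _ ≤ (e : ℚ) * (L / e + 1) := by gcongr
      _ = L + e := by field_simp
  exact_mod_cast h5

theorem sum_differenceCount_neg_mul_le {e : ℕ} (he : e ∣ q) (L : ℕ) :
    ∑ y : ZMod q, differenceCount L (-((e : ZMod q) * y)) ≤ L * (L + e) := by
  have he0 : 0 < e := Nat.pos_of_dvd_of_pos he (NeZero.pos q)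
  simp_rw [differenceCount, card_filter]
  rw [sum_comm, sum_product]
  calc _ ≤ ∑ i ∈ Icc 1 L, ∑ j ∈ Icc 1 L, if j ≡ i [MOD e] then e else 0 := by
        refine sum_le_sum fun i _ => sum_le_sum fun j _ => ?_
        rw [← card_filter]
        split_ifs with h
        · refine le_trans (card_le_card fun y hy => ?_)
            (card_filter_mul_eq_le he0 ((j : ZMod q) - (i : ZMod q)))
          rw [mem_filter] at hy ⊢
          refine ⟨mem_univ _, ?_⟩
          rw [← neg_sub, hy.2, neg_neg]
        · rw [Nat.le_zero, card_eq_zero, filter_eq_empty_iff]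
          intro y _ hy
          apply h
          rw [← ZMod.natCast_eq_natCast_iff]
          have := congrArg (ZMod.castHom he (ZMod e)) hy
          rw [map_sub, map_natCast, map_natCast, map_neg, map_mul, map_natCast, ZMod.natCast_self,
            zero_mul, neg_zero, sub_eq_zero] at this
          exact this.symm
    _ ≤ ∑ i ∈ Icc 1 L, (L + e) := by
        refine sum_le_sum fun i _ => ?_
        rw [← sum_filter, sum_const, smul_eq_mul, mul_comm]
        exact card_filter_modEq_le he0 L i
    _ = L * (L + e) := by simp

open Classical in
theorem sum_norm_sq_sum_Icc_le {e : ℕ} (he : e ∣ q) (L : ℕ) :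
    ∑ χ : AddChar (ZMod q) ℂ, (if ∀ x, χ (e * x) = 1 then ‖∑ i ∈ Icc 1 L, χ (i : ZMod q)‖ ^ 2 else 0)
      ≤ (L : ℝ) * (L + e) := by
  have hq : (q : ℂ) ≠ 0 := NeZero.ne _
  have h : ((∑ χ : AddChar (ZMod q) ℂ, (if ∀ x, χ (e * x) = 1 then
      ‖∑ i ∈ Icc 1 L, χ (i : ZMod q)‖ ^ 2 else 0 : ℝ) : ℝ) : ℂ) =
      ((∑ y : ZMod q, differenceCount L (-((e : ZMod q) * y)) : ℕ) : ℂ) := by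
    apply mul_left_cancel₀ hq
    push_cast
    rw [mul_sum, mul_sum]
    simp_rw [← sum_norm_sq_sum_Icc_mul, neg_neg]
    rw [sum_comm]
    refine sum_congr rfl fun χ _ => ?_
    rw [← mul_sum]
    have h2 := AddChar.sum_eq_ite (χ.mulShift e)
    have h3 : (χ.mulShift e = 0) ↔ ∀ x, χ (e * x) = 1 := by
      rw [DFunLike.ext_iff]; rfl
    simp only [AddChar.mulShift_apply, h3, ZMod.card] at h2
    rw [h2]
    split_ifs
    · push_cast; ring
    · simp
  have h' : (∑ χ : AddChar (ZMod q) ℂ, (if ∀ x, χ (e * x) = 1 then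
      ‖∑ i ∈ Icc 1 L, χ (i : ZMod q)‖ ^ 2 else 0 : ℝ)) =
      ((∑ y : ZMod q, differenceCount L (-((e : ZMod q) * y)) : ℕ) : ℝ) := by exact_mod_cast h
  rw [h']
  exact_mod_cast sum_differenceCount_neg_mul_le he L

theorem conductorWeight_mulShift {u v : ZMod q} (hu : IsUnit u) (hv : IsUnit v)
    (χ₁ χ₂ : AddChar (ZMod q) ℂ) :
    conductorWeight (χ₁.mulShift u) (χ₂.mulShift v) = conductorWeight χ₁ χ₂ := by
  have h : ∀ (χ : AddChar (ZMod q) ℂ) (w : ZMod q), IsUnit w → ∀ e : ℕ,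
      (∀ x, χ.mulShift w (e * x) = 1) ↔ ∀ x, χ (e * x) = 1 := by
    rintro χ _ ⟨w, rfl⟩ e
    simp only [AddChar.mulShift_apply]
    refine ⟨fun H x => ?_, fun H x => ?_⟩
    · have := H ((w⁻¹ : (ZMod q)ˣ) * x)
      rwa [mul_left_comm, Units.mul_inv_cancel_left] at this
    · have := H (w * x)
      rwa [mul_left_comm] at this
  rw [conductorWeight, conductorWeight]
  refine sum_congr rfl fun e _ => ?_
  have := and_congr (h χ₁ u hu e) (h χ₂ v hv e)
  split_ifs <;> tauto

/-- The smoothed count, bounded by completion and the Weil bound for complete sums. -/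
theorem sq_mul_sum_differenceCount_le (hq : Squarefree q) {a : ZMod q} (ha : IsUnit a) (L₁ L₂ : ℕ) :
    (q : ℝ) ^ 2 * ∑ u : (ZMod q)ˣ,
        differenceCount L₁ (a * ((u⁻¹ : (ZMod q)ˣ) : ZMod q) ^ 2) * differenceCount L₂ (u : ZMod q) ≤
      3 ^ q.primeFactors.card * √q * ∑ e ∈ q.divisors,
        √((q : ℝ) / e) * ((L₁ * (L₁ + e)) * (L₂ * (L₂ + e))) := by
  classical
  set f : AddChar (ZMod q) ℂ → ℝ := fun χ => ‖∑ i ∈ Icc 1 L₁, χ (i : ZMod q)‖ ^ 2 with hf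
  set g : AddChar (ZMod q) ℂ → ℝ := fun χ => ‖∑ i ∈ Icc 1 L₂, χ (i : ZMod q)‖ ^ 2 with hg
  have hf0 : ∀ χ, 0 ≤ f χ := fun χ => by positivity
  have hg0 : ∀ χ, 0 ≤ g χ := fun χ => by positivity
  have key := congrArg norm (sum_units_differenceCount_mul a L₁ L₂)
  rw [norm_mul, norm_pow, Complex.norm_natCast, Complex.norm_natCast] at key
  rw [key]
  calc _ ≤ ∑ χ₁ : AddChar (ZMod q) ℂ, ∑ χ₂ : AddChar (ZMod q) ℂ, f χ₁ * g χ₂ *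
        (3 ^ q.primeFactors.card * √q * conductorWeight χ₁ χ₂) := by
        refine norm_sum_le_of_le _ fun χ₁ _ => norm_sum_le_of_le _ fun χ₂ _ => ?_
        rw [norm_mul, norm_mul, Complex.norm_of_nonneg (hf0 χ₁), Complex.norm_of_nonneg (hg0 χ₂),
          ← conductorWeight_mulShift ha.neg isUnit_one.neg]
        exact mul_le_mul_of_nonneg_left (norm_unitCharSum_squarefree_le hq _ _)
          (mul_nonneg (hf0 _) (hg0 _))
    _ = 3 ^ q.primeFactors.card * √q * ∑ e ∈ q.divisors, √((q : ℝ) / e) *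
          ((∑ χ₁ : AddChar (ZMod q) ℂ, if ∀ x, χ₁ (e * x) = 1 then f χ₁ else 0) *
            ∑ χ₂ : AddChar (ZMod q) ℂ, if ∀ x, χ₂ (e * x) = 1 then g χ₂ else 0) := by
        symm
        simp_rw [sum_mul_sum, mul_sum]
        rw [sum_comm]
        refine sum_congr rfl fun χ₁ _ => ?_
        rw [sum_comm]
        refine sum_congr rfl fun χ₂ _ => ?_
        rw [conductorWeight, mul_sum, mul_sum]
        refine sum_congr rfl fun e _ => ?_
        by_cases h1 : ∀ x, χ₁ (e * x) = 1
        · by_cases h2 : ∀ x, χ₂ (e * x) = 1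
          · rw [if_pos h1, if_pos h2, if_pos ⟨h1, h2⟩]; ring
          · rw [if_neg h2, if_neg fun h : _ ∧ _ => h2 h.2]; simp
        · rw [if_neg h1, if_neg fun h : _ ∧ _ => h1 h.1]; simp
    _ ≤ _ := by
        refine mul_le_mul_of_nonneg_left (sum_le_sum fun e he => ?_) (by positivity)
        have he' := Nat.dvd_of_mem_divisors he
        refine mul_le_mul_of_nonneg_left ?_ (by positivity)
        refine mul_le_mul (sum_norm_sq_sum_Icc_le he' L₁) (sum_norm_sq_sum_Icc_le he' L₂) ?_
          (by positivity)
        exact sum_nonneg fun χ _ => by split_ifs <;> simp [hg0]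

end Completion

theorem card_divisors_of_squarefree {q : ℕ} (hq : Squarefree q) :
    q.divisors.card = 2 ^ q.primeFactors.card := by
  rw [Nat.card_divisors hq.ne_zero, ← prod_const]
  refine prod_congr rfl fun p hp => ?_
  have hp' := Nat.prime_of_mem_primeFactors hp
  have h1 := hq.natFactorization_le_one p
  have h2 := hp'.factorization_pos_of_dvd hq.ne_zero (Nat.dvd_of_mem_primeFactors hp)
  omega

theorem exists_pow_card_primeFactors_le {c ε : ℝ} (hc : 1 ≤ c) (hε : 0 < ε) :
    ∃ C : ℝ, 0 < C ∧ ∀ q : ℕ, Squarefree q → c ^ q.primeFactors.card ≤ C * (q : ℝ) ^ ε := by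
  obtain ⟨B, hB⟩ := exists_nat_ge (c ^ (1 / ε))
  refine ⟨c ^ B, by positivity, fun q hq => ?_⟩
  have h : (q : ℝ) ^ ε = ∏ p ∈ q.primeFactors, (p : ℝ) ^ ε := by
    rw [Real.finsetProd_rpow _ _ fun p _ => Nat.cast_nonneg p]
    rw [← Nat.cast_prod, Nat.prod_primeFactors_of_squarefree hq]
  calc c ^ q.primeFactors.card = ∏ p ∈ q.primeFactors, c := (prod_const c).symm
    _ ≤ ∏ p ∈ q.primeFactors, ((if p < B then c else 1) * (p : ℝ) ^ ε) := by
        refine prod_le_prod (fun _ _ => by positivity) fun p hp => ?_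
        have hp1 : (1 : ℝ) ≤ p := by exact_mod_cast (Nat.prime_of_mem_primeFactors hp).one_lt.le
        split_ifs with hpB
        · exact le_mul_of_one_le_right (by positivity) (Real.one_le_rpow hp1 hε.le)
        · rw [one_mul]
          have hBp : (B : ℝ) ≤ p := by exact_mod_cast not_lt.mp hpB
          calc c = (c ^ (1 / ε)) ^ ε := by
                rw [← Real.rpow_mul (by positivity), one_div_mul_cancel hε.ne', Real.rpow_one]
            _ ≤ _ := Real.rpow_le_rpow (by positivity) (hB.trans hBp) hε.le
    _ = c ^ (q.primeFactors.filter (· < B)).card * (q : ℝ) ^ ε := by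
        rw [prod_mul_distrib, ← h, ← prod_filter, prod_const]
    _ ≤ c ^ B * (q : ℝ) ^ ε := by
        refine mul_le_mul_of_nonneg_right (pow_le_pow_right₀ hc ?_) (by positivity)
        calc _ ≤ (range B).card := card_le_card fun p hp => by
              rw [mem_filter] at hp; exact mem_range.mpr hp.2
          _ = B := card_range B

theorem sqrt_div_mul_le {q e m n : ℝ} (he : 1 ≤ e) (heq : e ≤ q) (hm : 0 ≤ m) (hn : 0 ≤ n) :
    √(q / e) * ((m + e) * (n + e)) ≤ √q * (m * n + (m + n) * √q + q * √q) := by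
  have he0 : 0 < e := by linarith
  have hq0 : 0 < q := by linarith
  have hse : 1 ≤ √e := Real.one_le_sqrt.mpr he
  have hle : √e ≤ √q := Real.sqrt_le_sqrt heq
  have hee : √e * √e = e := Real.mul_self_sqrt he0.le
  have hkey : (m + e) * (n + e) ≤ √e * (m * n + (m + n) * √q + q * √q) := by
    have h1 : m * n ≤ √e * (m * n) := le_mul_of_one_le_left (by positivity) hse
    have h2 : (m + n) * e ≤ √e * ((m + n) * √q) := by
      calc (m + n) * e = √e * ((m + n) * √e) := by rw [mul_left_comm, hee]
        _ ≤ _ := by gcongr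
    have h3 : e * e ≤ √e * (q * √q) := by
      calc e * e = √e * (e * √e) := by rw [mul_left_comm, hee]
        _ ≤ _ := by gcongr
    linarith
  rw [Real.sqrt_div hq0.le, div_mul_eq_mul_div, div_le_iff₀ (by positivity), mul_assoc]
  refine mul_le_mul_of_nonneg_left ?_ (by positivity)
  rwa [mul_comm _ √e]

/-- Explicit bound, with constant `16 * 6 ^ ω(q)`, for the number of solutions of `m n² = a` in a box. -/
theorem card_filter_mul_sq_eq_le {q : ℕ} (hq : Squarefree q) {a : ZMod q} (ha : IsUnit a)
    {m n : ℕ} (hm : 0 < m) (hn : 0 < n) :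
    (((Icc 1 m ×ˢ Icc 1 n).filter fun r : ℕ × ℕ =>
        (r.1 : ZMod q) * (r.2 : ZMod q) ^ 2 = a).card : ℝ) ≤
      16 * 6 ^ q.primeFactors.card * (m * n / q + m / √q + n / √q + √q) := by
  have : NeZero q := ⟨hq.ne_zero⟩
  have hq0 : (0 : ℝ) < q := by exact_mod_cast NeZero.pos q
  have hm' : (0 : ℝ) < m := by exact_mod_cast hm
  have hn' : (0 : ℝ) < n := by exact_mod_cast hn
  set T := ((Icc 1 m ×ˢ Icc 1 n).filter fun r : ℕ × ℕ =>
    (r.1 : ZMod q) * (r.2 : ZMod q) ^ 2 = a).card with hT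
  have hcount : m * n * T ≤ ∑ u : (ZMod q)ˣ,
      differenceCount (2 * m) (a * ((u⁻¹ : (ZMod q)ˣ) : ZMod q) ^ 2) *
        differenceCount (2 * n) (u : ZMod q) := by
    refine (Nat.mul_le_mul_left _ (card_filter_le_sum_units ha _ _)).trans ?_
    rw [mul_sum]
    refine sum_le_sum fun u _ => ?_
    rw [mul_mul_mul_comm]
    exact Nat.mul_le_mul (mul_card_filter_le_differenceCount m _)
      (mul_card_filter_le_differenceCount n _)
  have hcount' : ((m * n * T : ℕ) : ℝ) ≤ _ := Nat.cast_le.mpr hcount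
  have hbound := (mul_le_mul_of_nonneg_left hcount' (sq_nonneg (q : ℝ))).trans
    (sq_mul_sum_differenceCount_le hq ha (2 * m) (2 * n))
  have hsum : ∑ e ∈ q.divisors, √((q : ℝ) / e) *
      (((2 * m : ℕ) * ((2 * m : ℕ) + e)) * ((2 * n : ℕ) * ((2 * n : ℕ) + e)) : ℝ) ≤
      2 ^ q.primeFactors.card * (4 * m * n *
        (√q * (2 * m * (2 * n) + (2 * m + 2 * n) * √q + q * √q))) := by
    rw [← Nat.cast_ofNat (R := ℝ) (n := 2), ← Nat.cast_pow, ← card_divisors_of_squarefree hq,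
      ← nsmul_eq_mul]
    refine sum_le_card_nsmul _ _ _ fun e he => ?_
    have he1 : (1 : ℝ) ≤ e := by exact_mod_cast Nat.pos_of_mem_divisors he
    have heq : (e : ℝ) ≤ q := by exact_mod_cast Nat.divisor_le he
    have := sqrt_div_mul_le he1 heq (m := 2 * m) (n := 2 * n) (by positivity) (by positivity)
    push_cast
    calc _ = 4 * (m : ℝ) * n * (√((q : ℝ) / e) * ((2 * m + e) * (2 * n + e))) := by ring
      _ ≤ _ := mul_le_mul_of_nonneg_left this (by positivity)
  have hs : √(q : ℝ) * √q = q := Real.mul_self_sqrt hq0.le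
  have hs0 : 0 < √(q : ℝ) := Real.sqrt_pos.mpr hq0
  have hfinal := hbound.trans (mul_le_mul_of_nonneg_left hsum (by positivity))
  have h6 : (6 : ℝ) ^ q.primeFactors.card = 3 ^ q.primeFactors.card * 2 ^ q.primeFactors.card := by
    rw [← mul_pow]; norm_num
  refine le_of_mul_le_mul_left ?_ (by positivity : (0 : ℝ) < q ^ 2 * (m * n))
  calc (q : ℝ) ^ 2 * (m * n) * T = q ^ 2 * ((m * n * T : ℕ) : ℝ) := by push_cast; ring
    _ ≤ _ := hfinal
    _ = 6 ^ q.primeFactors.card * (m * n) * (q * (16 * (m * n) + 8 * (m + n) * √q + 4 * q * √q)) := by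
        rw [h6]; linear_combination (3 ^ q.primeFactors.card * 2 ^ q.primeFactors.card * (4 * m * n *
          (2 * m * (2 * n) + (2 * m + 2 * n) * √q + q * √q))) * hs
    _ ≤ 6 ^ q.primeFactors.card * (m * n) * (q * (16 * (m * n) + 16 * (m + n) * √q + 16 * q * √q)) := by
        gcongr <;> norm_num
    _ = _ := by
        have e1 : (m : ℝ) / √q = m * √q / q := by
          rw [div_eq_div_iff hs0.ne' hq0.ne', mul_assoc, hs]
        have e2 : (n : ℝ) / √q = n * √q / q := by
          rw [div_eq_div_iff hs0.ne' hq0.ne', mul_assoc, hs]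
        rw [e1, e2]
        field_simp
        ring

/-- Weil-type bound: for every ε > 0 there is C = C(ε) such that for q squarefree, a
coprime to q, and M, N ≥ 1, the number of pairs (m,n) of positive integers with m ≤ M,
n ≤ N and m·n² ≡ a (mod q) is at most
C · q^ε · (M·N·q^(-1) + M·q^(-1/2) + N·q^(-1/2) + q^(1/2)). -/
theorem weil_bound_congruence_count :
    ∀ ε : ℝ, 0 < ε → ∃ C : ℝ, 0 < C ∧
      ∀ q : ℕ, Squarefree q → ∀ a : ℤ, Int.gcd a q = 1 →
        ∀ M N : ℝ, 1 ≤ M → 1 ≤ N →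
          ((((Finset.Icc 1 ⌊M⌋₊) ×ˢ (Finset.Icc 1 ⌊N⌋₊)).filter
              (fun p : ℕ × ℕ =>
                (p.1 : ZMod q) * (p.2 : ZMod q) ^ 2 = (a : ZMod q))).card : ℝ)
            ≤ C * (q : ℝ) ^ ε *
              (M * N * (q : ℝ) ^ (-1 : ℝ) + M * (q : ℝ) ^ (-(1 : ℝ) / 2)
                + N * (q : ℝ) ^ (-(1 : ℝ) / 2) + (q : ℝ) ^ ((1 : ℝ) / 2)) := by
  intro ε hε
  obtain ⟨C, hC, hCq⟩ := exists_pow_card_primeFactors_le (c := 6) (by norm_num) hε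
  refine ⟨16 * C, by positivity, fun q hq a ha M N hM hN => ?_⟩
  have hunit : IsUnit (a : ZMod q) := by
    rw [ZMod.coe_int_isUnit_iff_isCoprime, isCoprime_comm, Int.isCoprime_iff_gcd_eq_one]
    exact ha
  have hm : (⌊M⌋₊ : ℝ) ≤ M := Nat.floor_le (by linarith)
  have hn : (⌊N⌋₊ : ℝ) ≤ N := Nat.floor_le (by linarith)
  have hr1 : (q : ℝ) ^ (-(1 : ℝ) / 2) = (√q)⁻¹ := by
    rw [neg_div, Real.rpow_neg (Nat.cast_nonneg q), ← Real.sqrt_eq_rpow]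
  rw [Real.rpow_neg_one, hr1, ← Real.sqrt_eq_rpow]
  simp only [← div_eq_mul_inv]
  refine (card_filter_mul_sq_eq_le hq hunit (Nat.floor_pos.mpr hM) (Nat.floor_pos.mpr hN)).trans ?_
  rw [mul_assoc 16 C]
  have := hCq q hq
  gcongr
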